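/- The Belavin R-matrix satisfies the Yang–Baxter equation: for all generic ξ₁, ξ₂ ∈ ℂ one has R₁₂(z₁) · R₁₃(z₂) · R₂₃(z₂/z₁) = R₂₃(z₂/z₁) · R₁₃(z₂) · R₁₂(z₁) as linear operators on ℂ^N ⊗ ℂ^N ⊗ ℂ^N, where z₁ = e^{iπξ₁}, z₂ = e^{iπξ₂}, z₂/z₁ = e^{iπ(ξ₂−ξ₁)}, and R_{ab}(w) denotes the Belavin R-matrix evaluated at argument w acting on the a-th and b-th tensor factors and as the identity on the remaining factor. -/

import Mathlib

open Complex Matrix Kronecker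

noncomputable section

/-- `eπ x = exp(iπx)`; the variables `z, q, p` of the paper are `eπ ξ, eπ ζ, eπ (2τ)`. -/
def eπ (x : ℂ) : ℂ := Complex.exp (Real.pi * Complex.I * x)

/-- Jacobi theta function with characteristics `ϑ[γ₁,γ₂](u,τ)`. -/
def jTheta (γ₁ γ₂ : ℝ) (u τ : ℂ) : ℂ :=
  ∑' m : ℤ, Complex.exp (Real.pi * Complex.I * ((m : ℂ) + (γ₁ : ℂ)) ^ 2 * τ +
    2 * Real.pi * Complex.I * ((m : ℂ) + (γ₁ : ℂ)) * (u + (γ₂ : ℂ)))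

/-- single infinite Pochhammer symbol `(x;s)_∞`. -/
def poch1 (x s : ℂ) : ℂ := ∏' n : ℕ, (1 - x * s ^ n)

/-- double infinite Pochhammer symbol `(x;p₁,p₂)_∞`. -/
def poch2 (x p₁ p₂ : ℂ) : ℂ := ∏' n : ℕ × ℕ, (1 - x * p₁ ^ n.1 * p₂ ^ n.2)

/-- Jacobi `Θ_s(x)` function. -/
def ThetaF (s x : ℂ) : ℂ := poch1 x s * poch1 (s * x⁻¹) s * poch1 s s

/-- numerator of `1/κ(z²)`, with `z = eπ ξ`, `q = eπ ζ`, `p = eπ (2τ)`. -/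
def kappaNum (N : ℕ) (ξ ζ τ : ℂ) : ℂ :=
  poch2 (eπ (2 * N * ζ - 2 * ξ)) (eπ (2 * τ)) (eπ (2 * N * ζ)) *
  poch2 (eπ (2 * ζ + 2 * ξ)) (eπ (2 * τ)) (eπ (2 * N * ζ)) *
  poch2 (eπ (2 * τ - 2 * ξ)) (eπ (2 * τ)) (eπ (2 * N * ζ)) *
  poch2 (eπ (2 * τ + (2 * N - 2) * ζ + 2 * ξ)) (eπ (2 * τ)) (eπ (2 * N * ζ))

/-- denominator of `1/κ(z²)`: the numerator with `ξ → -ξ`. -/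
def kappaDen (N : ℕ) (ξ ζ τ : ℂ) : ℂ := kappaNum N (-ξ) ζ τ

/-- the diagonal matrix `g^{1/2}` with entries `e^{iπj/N}`, `1 ≤ j ≤ N`. -/
def gHalf (N : ℕ) : Matrix (Fin N) (Fin N) ℂ :=
  Matrix.diagonal fun j => eπ ((((j : ℕ) : ℂ) + 1) / N)

/-- the diagonal matrix `g` with entries `ω^j = e^{2iπj/N}`, `1 ≤ j ≤ N`. -/
def gMat (N : ℕ) : Matrix (Fin N) (Fin N) ℂ :=
  Matrix.diagonal fun j => eπ (2 * (((j : ℕ) : ℂ) + 1) / N)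

/-- the shift matrix `h`, `h_{jl} = δ_{j+1,l}` (mod `N`). -/
def hMat (N : ℕ) : Matrix (Fin N) (Fin N) ℂ :=
  Matrix.of fun j l => if (l : ℕ) = ((j : ℕ) + 1) % N then 1 else 0

/-- `I_{(α₁,α₂)} = g^{α₂} h^{α₁}`. -/
def Imat (N : ℕ) (α : Fin N × Fin N) : Matrix (Fin N) (Fin N) ℂ :=
  gMat N ^ (α.2 : ℕ) * hMat N ^ (α.1 : ℕ)

/-- the coefficient `W_{(α₁,α₂)}(ξ,ζ,τ)`. -/
def Wcoef (N : ℕ) (α : Fin N × Fin N) (ξ ζ τ : ℂ) : ℂ :=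
  jTheta (1/2 + (α.1 : ℕ) / N) (1/2 + (α.2 : ℕ) / N) (ξ + ζ / N) τ /
    (N * jTheta (1/2 + (α.1 : ℕ) / N) (1/2 + (α.2 : ℕ) / N) (ζ / N) τ)

/-- the matrix `𝒵(z)`, `z = eπ ξ`. -/
def Zmat (N : ℕ) (ξ ζ τ : ℂ) : Matrix (Fin N × Fin N) (Fin N × Fin N) ℂ :=
  (eπ (ξ * (2 / N - 2)) * (kappaNum N ξ ζ τ / kappaDen N ξ ζ τ) *
      jTheta (1/2) (1/2) ζ τ / jTheta (1/2) (1/2) (ξ + ζ) τ) •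
    ∑ α : Fin N × Fin N, Wcoef N α ξ ζ τ • (Imat N α ⊗ₖ (Imat N α)⁻¹)

/-- the Belavin R-matrix `R(z)`, as a function of `ξ` with `z = eπ ξ`. -/
def Rmat (N : ℕ) (ξ ζ τ : ℂ) : Matrix (Fin N × Fin N) (Fin N × Fin N) ℂ :=
  (gHalf N ⊗ₖ gHalf N) * Zmat N ξ ζ τ * (gHalf N ⊗ₖ gHalf N)⁻¹

/-- genericity: every theta-function value and κ-value appearing in a denominator is nonzero. -/
def Rgeneric (N : ℕ) (ξ ζ τ : ℂ) : Prop :=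
  jTheta (1/2) (1/2) (ξ + ζ) τ ≠ 0 ∧
  (∀ α : Fin N × Fin N,
    jTheta (1/2 + (α.1 : ℕ) / N) (1/2 + (α.2 : ℕ) / N) (ζ / N) τ ≠ 0) ∧
  kappaDen N ξ ζ τ ≠ 0

/-- the flip (permutation) operator `P` on `ℂ^N ⊗ ℂ^N`. -/
def Pflip (N : ℕ) : Matrix (Fin N × Fin N) (Fin N × Fin N) ℂ :=
  Matrix.of fun a b => if a.1 = b.2 ∧ a.2 = b.1 then 1 else 0

/-- partial transposition in the second tensor factor. -/
def pt2 {N : ℕ} (M : Matrix (Fin N × Fin N) (Fin N × Fin N) ℂ) :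
    Matrix (Fin N × Fin N) (Fin N × Fin N) ℂ :=
  Matrix.of fun a b => M (a.1, b.2) (b.1, a.2)

/-- `τ_N` evaluated at `eπ u` (all fractional powers via exponentials). -/
def tauNe (N : ℕ) (ζ u : ℂ) : ℂ :=
  eπ (u * (2 / N - 2)) * ThetaF (eπ (2 * N * ζ)) (eπ (ζ + 2 * u)) /
    ThetaF (eπ (2 * N * ζ)) (eπ (ζ - 2 * u))

/-- the normalized Belavin R-matrix `R̂(z) = τ_N(q^{1/2}z⁻¹) R(z)`, as a function of `ξ`. -/
def Rhat (N : ℕ) (ξ ζ τ : ℂ) : Matrix (Fin N × Fin N) (Fin N × Fin N) ℂ :=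
  tauNe N ζ (ζ / 2 - ξ) • Rmat N ξ ζ τ


/-- `R₁₂(w)` acting on the triple tensor product. -/
def R12of (N : ℕ) (M : Matrix (Fin N × Fin N) (Fin N × Fin N) ℂ) :
    Matrix (Fin N × Fin N × Fin N) (Fin N × Fin N × Fin N) ℂ :=
  Matrix.of fun a b => M (a.1, a.2.1) (b.1, b.2.1) * (if a.2.2 = b.2.2 then 1 else 0)

/-- `R₁₃(w)` acting on the triple tensor product. -/
def R13of (N : ℕ) (M : Matrix (Fin N × Fin N) (Fin N × Fin N) ℂ) :
    Matrix (Fin N × Fin N × Fin N) (Fin N × Fin N × Fin N) ℂ :=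
  Matrix.of fun a b => M (a.1, a.2.2) (b.1, b.2.2) * (if a.2.1 = b.2.1 then 1 else 0)

/-- `R₂₃(w)` acting on the triple tensor product. -/
def R23of (N : ℕ) (M : Matrix (Fin N × Fin N) (Fin N × Fin N) ℂ) :
    Matrix (Fin N × Fin N × Fin N) (Fin N × Fin N × Fin N) ℂ :=
  Matrix.of fun a b => M (a.2.1, a.2.2) (b.2.1, b.2.2) * (if a.1 = b.1 then 1 else 0)

lemma bel_summable (z : ℂ) {τ : ℂ} (hτ : 0 < τ.im) : Summable (fun n : ℤ => ‖jacobiTheta₂_term n z τ‖) :=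
  ((summable_jacobiTheta₂_term_iff z τ).mpr hτ).norm

/-- splitting of pairs of integers by parity of the sum -/
def bel_equiv : (ℤ × ℤ) ⊕ (ℤ × ℤ) ≃ ℤ × ℤ where
  toFun := Sum.elim (fun p => (p.1 + p.2, p.1 - p.2)) (fun p => (p.1 + p.2 + 1, p.1 - p.2))
  invFun p := if (p.1 + p.2) % 2 = 0 then Sum.inl ((p.1 + p.2) / 2, (p.1 - p.2) / 2)
    else Sum.inr ((p.1 + p.2 - 1) / 2, (p.1 - p.2 - 1) / 2)
  left_inv := by
    rintro (⟨s, d⟩ | ⟨s, d⟩)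
    · have : (s + d + (s - d)) % 2 = 0 := by omega
      simp only [Sum.elim_inl, this, if_true]
      congr 2 <;> omega
    · have : ¬ (s + d + 1 + (s - d)) % 2 = 0 := by omega
      simp only [Sum.elim_inr, this, if_false]
      congr 2 <;> omega
  right_inv := by
    rintro ⟨m, n⟩
    by_cases h : (m + n) % 2 = 0
    · simp only [h, if_true, Sum.elim_inl]
      ext <;> simp <;> omega
    · simp only [h, if_false, Sum.elim_inr]
      ext <;> simp <;> omega

lemma bel_P (u v : ℂ) {σ : ℂ} (hσ : 0 < σ.im) : HasSum (fun p : ℤ × ℤ => jacobiTheta₂_term p.1 u σ *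
      jacobiTheta₂_term p.2 v σ) (jacobiTheta₂ u σ * jacobiTheta₂ v σ) := by
  have h := (summable_mul_of_summable_norm (bel_summable u hσ) (bel_summable v hσ)).hasSum
  rw [← tsum_mul_tsum_of_summable_norm (bel_summable u hσ) (bel_summable v hσ)] at h
  exact h

lemma bel_e1 (a b τ : ℂ) (p : ℤ × ℤ) : jacobiTheta₂_term (bel_equiv (Sum.inl p)).1 a τ *
      jacobiTheta₂_term (bel_equiv (Sum.inl p)).2 b τ = jacobiTheta₂_term p.1 (a + b) (2 * τ) *
      jacobiTheta₂_term p.2 (a - b) (2 * τ) := by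
  simp only [bel_equiv, Equiv.coe_fn_mk, Sum.elim_inl, jacobiTheta₂_term,
      ← Complex.exp_add]
  congr 1
  push_cast
  ring

lemma bel_e2 (a b τ : ℂ) (p : ℤ × ℤ) : jacobiTheta₂_term (bel_equiv (Sum.inr p)).1 a τ *
      jacobiTheta₂_term (bel_equiv (Sum.inr p)).2 b τ =
      cexp (Real.pi * I * τ + 2 * Real.pi * I * a) *
      (jacobiTheta₂_term p.1 (a + b + τ) (2 * τ) * jacobiTheta₂_term p.2 (a - b + τ) (2 * τ)) := by
  simp only [bel_equiv, Equiv.coe_fn_mk, Sum.elim_inr, jacobiTheta₂_term,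
      ← Complex.exp_add]
  congr 1
  push_cast
  ring

lemma bel_J_mul (a b : ℂ) {τ : ℂ} (hτ : 0 < τ.im) :
    jacobiTheta₂ a τ * jacobiTheta₂ b τ =
      jacobiTheta₂ (a + b) (2 * τ) * jacobiTheta₂ (a - b) (2 * τ) +
      cexp (Real.pi * I * τ + 2 * Real.pi * I * a) *
        (jacobiTheta₂ (a + b + τ) (2 * τ) * jacobiTheta₂ (a - b + τ) (2 * τ)) := by
  have h2 : 0 < (2 * τ).im := by simpa using hτ
  have L := (bel_equiv.hasSum_iff).mpr (bel_P a b hτ)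
  refine L.unique (HasSum.sum ?_ ?_)
  · simp only [Function.comp_def, bel_e1 a b τ]
    exact bel_P (a + b) (a - b) h2
  · simp only [Function.comp_def, bel_e2 a b τ]
    exact (bel_P (a + b + τ) (a - b + τ) h2).mul_left _

lemma bel_exp_neg (x : ℂ) : - cexp x = cexp (x + Real.pi * I) := by
  rw [Complex.exp_add, Complex.exp_pi_mul_I, mul_neg_one]

/-- the odd theta function -/
def bth (τ u : ℂ) : ℂ := jTheta (1/2) (1/2) u τ

lemma bel_jTheta (g₁ g₂ : ℝ) (u τ : ℂ) :
    jTheta g₁ g₂ u τ = cexp (Real.pi * I * g₁ ^ 2 * τ + 2 * Real.pi * I * g₁ * (u + g₂)) *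
      jacobiTheta₂ (u + g₂ + g₁ * τ) τ := by
  rw [jTheta, jacobiTheta₂, ← tsum_mul_left]
  refine tsum_congr fun m => ?_
  rw [jacobiTheta₂_term, ← Complex.exp_add]
  congr 1
  ring

lemma bth_eq (τ u : ℂ) : bth τ u = cexp (Real.pi * I * τ / 4 + Real.pi * I * (u + 1/2)) *
    jacobiTheta₂ (u + 1/2 + τ / 2) τ := by
  rw [bth, bel_jTheta]
  push_cast
  congr 2 <;> ring

lemma bel_jTheta_shift (a b : ℝ) (u τ : ℂ) :
    jTheta (1/2 + a) (1/2 + b) u τ =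
      cexp (Real.pi * I * a ^ 2 * τ + 2 * Real.pi * I * a * (u + 1/2 + b)) *
        bth τ (u + (a * τ + b)) := by
  rw [bel_jTheta, bth_eq, ← mul_assoc, ← Complex.exp_add]
  push_cast
  congr 2 <;> ring

lemma bth_differentiable {τ : ℂ} (hτ : 0 < τ.im) : Differentiable ℂ (bth τ) := by
  have : bth τ = fun u => cexp (Real.pi * I * τ / 4 + Real.pi * I * (u + 1/2)) *
    jacobiTheta₂ (u + 1/2 + τ / 2) τ := funext (bth_eq τ)
  rw [this]
  intro u
  refine DifferentiableAt.mul (by fun_prop) ?_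
  exact (differentiableAt_jacobiTheta₂_fst (u + 1/2 + τ / 2) hτ).comp u
    (f := fun u : ℂ => u + 1/2 + τ / 2) (by fun_prop)

lemma bth_add_one (τ u : ℂ) : bth τ (u + 1) = - bth τ u := by
  rw [bth_eq, bth_eq, show u + 1 + 1/2 + τ/2 = u + 1/2 + τ/2 + 1 by ring, jacobiTheta₂_add_left,
    show (Real.pi * I * τ / 4 + Real.pi * I * (u + 1 + 1/2) : ℂ) =
      (Real.pi * I * τ / 4 + Real.pi * I * (u + 1/2)) + Real.pi * I by ring, Complex.exp_add,
      Complex.exp_pi_mul_I]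
  ring

lemma bth_add_tau (τ u : ℂ) : bth τ (u + τ) = - cexp (-(Real.pi * I * τ + 2 * Real.pi * I * u)) *
    bth τ u := by
  rw [bth_eq, bth_eq, show u + τ + 1/2 + τ/2 = u + 1/2 + τ/2 + τ by ring, jacobiTheta₂_add_left',
    ← mul_assoc, ← mul_assoc, bel_exp_neg, ← Complex.exp_add, ← Complex.exp_add]
  congr 1
  rw [Complex.exp_eq_exp_iff_exists_int]
  refine ⟨-1, ?_⟩
  push_cast
  ring

lemma bth_neg (τ u : ℂ) : bth τ (-u) = - bth τ u := by
  have h1 := bth_eq τ (-u)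
  rw [← jacobiTheta₂_neg_left, show -(-u + 1/2 + τ/2) = u + -1/2 - τ/2 by ring] at h1
  have h2 := bth_eq τ u
  rw [show u + 1/2 + τ/2 = (u + -1/2 - τ/2) + τ + 1 by ring, jacobiTheta₂_add_left,
    jacobiTheta₂_add_left'] at h2
  rw [h1, h2, ← mul_assoc, ← Complex.exp_add, ← neg_mul, bel_exp_neg]
  congr 1
  rw [Complex.exp_eq_exp_iff_exists_int]
  refine ⟨-1, ?_⟩
  push_cast
  ring

lemma bth_zero (τ : ℂ) : bth τ 0 = 0 := by
  have := bth_neg τ 0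
  rw [neg_zero] at this
  exact self_eq_neg.mp this

/-- even part -/
def bE (τ x : ℂ) : ℂ := jacobiTheta₂ (2 * x) (2 * τ)
/-- odd part -/
def bO (τ x : ℂ) : ℂ := cexp (Real.pi * I * τ / 2 + 2 * Real.pi * I * x) * 
  jacobiTheta₂ (2 * x + τ) (2 * τ)

lemma bE_differentiable {τ : ℂ} (hτ : 0 < τ.im) : Differentiable ℂ (bE τ) := by
  have h2 : 0 < (2 * τ).im := by simpa using hτ
  intro u
  exact (differentiableAt_jacobiTheta₂_fst (2 * u) h2).comp u
    (f := fun u : ℂ => 2 * u) (by fun_prop)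

lemma bO_differentiable {τ : ℂ} (hτ : 0 < τ.im) : Differentiable ℂ (bO τ) := by
  have h2 : 0 < (2 * τ).im := by simpa using hτ
  intro u
  refine DifferentiableAt.mul (by fun_prop) ?_
  exact (differentiableAt_jacobiTheta₂_fst (2 * u + τ) h2).comp u
    (f := fun u : ℂ => 2 * u + τ) (by fun_prop)

lemma bth_mul {τ : ℂ} (hτ : 0 < τ.im) (x y : ℂ) :
    bth τ (x + y) * bth τ (x - y) = bE τ x * bO τ y - bO τ x * bE τ y := by
  have h := bel_J_mul (x + y + 1/2 + τ/2) (x - y + 1/2 + τ/2) hτ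
  rw [show x + y + 1/2 + τ/2 + (x - y + 1/2 + τ/2) = 2 * x + τ + 1 by ring,
    show x + y + 1/2 + τ/2 - (x - y + 1/2 + τ/2) = 2 * y by ring,
    show 2 * x + τ + 1 + τ = 2 * x + 2 * τ + 1 by ring,
    jacobiTheta₂_add_left, jacobiTheta₂_add_left, jacobiTheta₂_add_left'] at h
  rw [bth_eq, bth_eq, mul_mul_mul_comm, h, bE, bO, bO, bE]
  have e1 : cexp (Real.pi * I * τ / 4 + Real.pi * I * (x + y + 1/2)) *
      cexp (Real.pi * I * τ / 4 + Real.pi * I * (x - y + 1/2)) =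
      - cexp (Real.pi * I * τ / 2 + 2 * Real.pi * I * x) := by
    rw [bel_exp_neg, ← Complex.exp_add]
    congr 1
    ring
  have e2 : - cexp (Real.pi * I * τ / 2 + 2 * Real.pi * I * x) *
      (cexp (Real.pi * I * τ + 2 * Real.pi * I * (x + y + 1/2 + τ/2)) *
      cexp (-Real.pi * I * (2 * τ + 2 * (2 * x)))) =
      cexp (Real.pi * I * τ / 2 + 2 * Real.pi * I * y) := by
    rw [bel_exp_neg, ← Complex.exp_add, ← Complex.exp_add, Complex.exp_eq_exp_iff_exists_int]
    refine ⟨1, ?_⟩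
    push_cast
    ring
  rw [e1, ← e2]
  ring

lemma bth_weierstrass {τ : ℂ} (hτ : 0 < τ.im) (x y z w : ℂ) :
    bth τ (x + y) * bth τ (x - y) * (bth τ (z + w) * bth τ (z - w)) =
    bth τ (x + z) * bth τ (x - z) * (bth τ (y + w) * bth τ (y - w)) -
    bth τ (x + w) * bth τ (x - w) * (bth τ (y + z) * bth τ (y - z)) := by
  simp only [bth_mul hτ]
  ring

open Topology Filter in
lemma bth_ev {τ : ℂ} (hτ : 0 < τ.im) (hne : ∃ u, bth τ u ≠ 0) {a : ℂ} (ha : a ≠ 0) (b t₀ : ℂ) :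
    ∀ᶠ t in 𝓝[≠] t₀, bth τ (a * t + b) ≠ 0 := by
  have hd : Differentiable ℂ (fun t => bth τ (a * t + b)) :=
    (bth_differentiable hτ).comp (by fun_prop)
  have han : AnalyticOnNhd ℂ (fun t => bth τ (a * t + b)) Set.univ := fun t _ => hd.analyticAt t
  rcases (han t₀ trivial).eventually_eq_zero_or_eventually_ne_zero with h | h
  · exfalso
    have := han.eqOn_zero_of_preconnected_of_eventuallyEq_zero isPreconnected_univ
      (Set.mem_univ t₀) h
    obtain ⟨u, hu⟩ := hne
    have h2 := this (Set.mem_univ ((u - b) / a))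
    simp only [Pi.zero_apply] at h2
    rw [mul_div_cancel₀ _ ha, sub_add_cancel] at h2
    exact hu h2
  · exact h

open Topology Filter in
lemma bv_ne {τ : ℂ} (hτ : 0 < τ.im) (hne : ∃ u, bth τ u ≠ 0) (x : ℂ) (hE : bE τ x = 0) :
    bO τ x ≠ 0 := by
  intro hO
  have h1 := bth_ev hτ hne one_ne_zero x 0
  have h2 := bth_ev hτ hne (neg_ne_zero.mpr one_ne_zero) x 0
  obtain ⟨t, ht1, ht2⟩ := (h1.and h2).exists
  have := bth_mul hτ x t
  rw [hE, hO, zero_mul, zero_mul, sub_zero] at this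
  rcases mul_eq_zero.mp this with h | h
  · exact ht1 (by rw [← h]; ring_nf)
  · exact ht2 (by rw [← h]; ring_nf)

open Topology Filter in
lemma bth_deriv_ne {τ : ℂ} (hτ : 0 < τ.im) (hne : ∃ u, bth τ u ≠ 0) :
    deriv (bth τ) 0 ≠ 0 := by
  intro h0
  have W : ∀ x, bE τ x * deriv (bO τ) x = bO τ x * deriv (bE τ) x := by
    intro x
    have dth : ∀ u, HasDerivAt (bth τ) (deriv (bth τ) u) u := fun u =>
      (bth_differentiable hτ u).hasDerivAt
    have A : HasDerivAt (fun y => bth τ (x + y) * bth τ (x - y))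
        (deriv (bth τ) (x + x) * bth τ (x - x) + bth τ (x + x) * (-deriv (bth τ) (x - x))) x :=
      ((dth (x + x)).comp_const_add x x).mul ((dth (x - x)).comp_const_sub x x)
    have B : HasDerivAt (fun y => bE τ x * bO τ y - bO τ x * bE τ y)
        (bE τ x * deriv (bO τ) x - bO τ x * deriv (bE τ) x) x :=
      ((bO_differentiable hτ x).hasDerivAt.const_mul _).sub
        ((bE_differentiable hτ x).hasDerivAt.const_mul _)
    have hfun : (fun y => bth τ (x + y) * bth τ (x - y)) =
        fun y => bE τ x * bO τ y - bO τ x * bE τ y := funext fun y => bth_mul hτ x y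
    rw [hfun] at A
    have := A.unique B
    rw [sub_self, h0, bth_zero] at this
    linear_combination -this
  obtain ⟨x₀, hx₀⟩ : ∃ x, bE τ x ≠ 0 := by
    by_contra hcon
    push Not at hcon
    obtain ⟨t, ht1, ht2⟩ := ((bth_ev hτ hne one_ne_zero 0 0).and
      (bth_ev hτ hne (neg_ne_zero.mpr one_ne_zero) 0 0)).exists
    have := bth_mul hτ 0 t
    rw [hcon, hcon] at this
    simp only [zero_add, zero_sub, one_mul, add_zero, neg_one_mul, zero_mul, mul_zero, sub_zero,
      mul_eq_zero] at this ht1 ht2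
    tauto
  have hopen : IsOpen {x | bE τ x ≠ 0} :=
    isOpen_ne.preimage (bE_differentiable hτ).continuous
  obtain ⟨r, hr, hball⟩ := Metric.isOpen_iff.mp hopen x₀ hx₀
  have hEO : ∀ x ∈ Metric.ball x₀ r, bO τ x / bE τ x = bO τ x₀ / bE τ x₀ := by
    intro x hx
    refine Metric.isOpen_ball.is_const_of_deriv_eq_zero (convex_ball x₀ r).isPreconnected
      (f := fun x => bO τ x / bE τ x) ?_ ?_ hx (Metric.mem_ball_self hr)
    · intro y hy
      exact ((bO_differentiable hτ y).div (bE_differentiable hτ y) (hball hy)).differentiableWithinAt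
    · intro y hy
      have := ((bO_differentiable hτ y).hasDerivAt.fun_div (bE_differentiable hτ y).hasDerivAt
        (hball hy)).deriv
      rw [this]
      simp only [Pi.zero_apply, div_eq_zero_iff]
      left
      linear_combination W y
  obtain ⟨t, ⟨ht1, ht2⟩, ht3⟩ := (((bth_ev hτ hne one_ne_zero x₀ x₀).and
    (bth_ev hτ hne (neg_ne_zero.mpr one_ne_zero) x₀ x₀)).and
      (mem_nhdsWithin_of_mem_nhds (Metric.ball_mem_nhds x₀ hr))).exists
  have h := bth_mul hτ x₀ t
  have h2 := hEO t ht3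
  have h3 : bE τ t ≠ 0 := hball ht3
  rw [div_eq_div_iff h3 hx₀] at h2
  rw [show bE τ x₀ * bO τ t - bO τ x₀ * bE τ t = 0 by linear_combination h2] at h
  rcases mul_eq_zero.mp h with h | h
  · exact ht1 (by rw [← h]; ring_nf)
  · exact ht2 (by rw [← h]; ring_nf)

lemma bE_half (τ x : ℂ) : bE τ (x + 1/2) = bE τ x := by
  rw [bE, bE, show 2 * (x + 1/2) = 2 * x + 1 by ring, jacobiTheta₂_add_left]

lemma bO_half (τ x : ℂ) : bO τ (x + 1/2) = - bO τ x := by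
  rw [bO, bO, show 2 * (x + 1/2) + τ = 2 * x + τ + 1 by ring, jacobiTheta₂_add_left, ← neg_mul,
    bel_exp_neg]
  congr 2
  ring

lemma bE_tau (τ x : ℂ) : bE τ (x + τ/2) =
    cexp (-(Real.pi * I * τ / 2 + 2 * Real.pi * I * x)) * bO τ x := by
  rw [bE, bO, show 2 * (x + τ/2) = 2 * x + τ by ring, ← mul_assoc, ← Complex.exp_add,
    neg_add_cancel, Complex.exp_zero, one_mul]

lemma bO_tau (τ x : ℂ) : bO τ (x + τ/2) =
    cexp (-(Real.pi * I * τ / 2 + 2 * Real.pi * I * x)) * bE τ x := by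
  rw [bE, bO, show 2 * (x + τ/2) + τ = 2 * x + 2 * τ by ring, jacobiTheta₂_add_left', ← mul_assoc,
    ← Complex.exp_add]
  congr 2
  ring

/-- a continuous function, doubly periodic for `1/2, τ/2`, is bounded -/
lemma bel_bounded {τ : ℂ} (hτ : 0 < τ.im) (f : ℂ → ℂ) (hf : Continuous f)
    (h1 : ∀ x, ‖f (x + 1/2)‖ = ‖f x‖) (h2 : ∀ x, ‖f (x + τ/2)‖ = ‖f x‖) :
    Bornology.IsBounded (Set.range f) := by
  have p1 : Function.Periodic (fun x => ‖f x‖) (1/2) := h1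
  have p2 : Function.Periodic (fun x => ‖f x‖) (τ/2) := h2
  obtain ⟨C, hC⟩ := (isCompact_closedBall (0 : ℂ) (1/2 + ‖τ‖/2)).exists_bound_of_continuousOn
    hf.continuousOn
  rw [isBounded_iff_forall_norm_le]
  refine ⟨C, ?_⟩
  rintro _ ⟨x, rfl⟩
  set t : ℝ := x.im / τ.im with ht
  set s : ℝ := x.re - t * τ.re with hs
  have hx : x = s + t * τ := by
    apply Complex.ext
    · simp [hs]
    · simp [ht, hτ.ne']
  set x' : ℂ := (Int.fract (2 * s) / 2 : ℝ) + (Int.fract (2 * t) / 2 : ℝ) * τ with hx'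
  have hxx : x = x' + (⌊2 * s⌋ : ℂ) * (1/2) + (⌊2 * t⌋ : ℂ) * (τ/2) := by
    rw [hx, hx', Int.fract, Int.fract]
    push_cast
    ring
  have e1 := p2.int_mul ⌊2 * t⌋ (x' + (⌊2 * s⌋ : ℂ) * (1/2))
  have e2 := p1.int_mul ⌊2 * s⌋ x'
  rw [hxx, e1, e2]
  apply hC
  rw [mem_closedBall_zero_iff]
  refine (norm_add_le _ _).trans (add_le_add ?_ ?_)
  · rw [Complex.norm_real, Real.norm_of_nonneg (by have := Int.fract_nonneg (2 * s); linarith)]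
    have := Int.fract_lt_one (2 * s)
    linarith
  · rw [norm_mul, Complex.norm_real,
      Real.norm_of_nonneg (by have := Int.fract_nonneg (2 * t); linarith)]
    have := Int.fract_lt_one (2 * t)
    have h3 := norm_nonneg τ
    nlinarith

open Topology Filter in
lemma bth_zeros {τ : ℂ} (hτ : 0 < τ.im) (hne : ∃ u, bth τ u ≠ 0) (a b : ℝ)
    (hc : bth τ (a * τ + b) = 0) : (∃ m : ℤ, a = m) ∧ (∃ n : ℤ, b = n) := by
  set c : ℂ := a * τ + b with hcdef
  have key : ∀ x, bE τ x * bO τ (x - c) = bO τ x * bE τ (x - c) := by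
    intro x
    have := bth_mul hτ x (x - c)
    rw [show x - (x - c) = c by ring, hc, mul_zero] at this
    linear_combination -this
  obtain ⟨μ, hμ⟩ : ∃ μ : ℂ → ℂ, ∀ x, bE τ (x - c) = μ x * bE τ x ∧ bO τ (x - c) = μ x * bO τ x := by
    have : ∀ x, ∃ m : ℂ, bE τ (x - c) = m * bE τ x ∧ bO τ (x - c) = m * bO τ x := by
      intro x
      by_cases hE : bE τ x = 0
      · have hO := bv_ne hτ hne x hE
        refine ⟨bO τ (x - c) / bO τ x, ?_, ?_⟩
        · rw [div_mul_eq_mul_div, eq_div_iff hO]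
          linear_combination -key x
        · rw [div_mul_cancel₀ _ hO]
      · refine ⟨bE τ (x - c) / bE τ x, ?_, ?_⟩
        · rw [div_mul_cancel₀ _ hE]
        · rw [div_mul_eq_mul_div, eq_div_iff hE]
          linear_combination key x
    choose μ hμ using this
    exact ⟨μ, hμ⟩
  have huniq : ∀ x m, bE τ (x - c) = m * bE τ x → bO τ (x - c) = m * bO τ x → μ x = m := by
    intro x m h1 h2
    by_cases hE : bE τ x = 0
    · have hO := bv_ne hτ hne x hE
      exact mul_right_cancel₀ hO ((hμ x).2.symm.trans h2)
    · exact mul_right_cancel₀ hE ((hμ x).1.symm.trans h1)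
  have dE := bE_differentiable hτ
  have dO := bO_differentiable hτ
  have hdiff : Differentiable ℂ μ := by
    intro x
    by_cases hE : bE τ x = 0
    · have hO := bv_ne hτ hne x hE
      have hev : ∀ᶠ y in 𝓝 x, bO τ y ≠ 0 := dO.continuous.continuousAt.eventually_ne hO
      have : μ =ᶠ[𝓝 x] fun y => bO τ (y - c) / bO τ y := by
        filter_upwards [hev] with y hy
        rw [(hμ y).2, mul_div_cancel_right₀ _ hy]
      refine DifferentiableAt.congr_of_eventuallyEq ?_ this
      exact DifferentiableAt.div ((dO (x - c)).comp x (f := fun y => y - c) (by fun_prop)) (dO x) hO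
    · have hev : ∀ᶠ y in 𝓝 x, bE τ y ≠ 0 := dE.continuous.continuousAt.eventually_ne hE
      have : μ =ᶠ[𝓝 x] fun y => bE τ (y - c) / bE τ y := by
        filter_upwards [hev] with y hy
        rw [(hμ y).1, mul_div_cancel_right₀ _ hy]
      refine DifferentiableAt.congr_of_eventuallyEq ?_ this
      exact DifferentiableAt.div ((dE (x - c)).comp x (f := fun y => y - c) (by fun_prop)) (dE x) hE
  have per1 : ∀ x, μ (x + 1/2) = μ x := by
    intro x
    apply huniq
    · rw [show x + 1/2 - c = x - c + 1/2 by ring, bE_half, bE_half, (hμ x).1]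
    · rw [show x + 1/2 - c = x - c + 1/2 by ring, bO_half, bO_half, (hμ x).2]
      ring
  have hexp : ∀ x : ℂ, cexp (-(Real.pi * I * τ / 2 + 2 * Real.pi * I * (x - c))) =
      cexp (2 * Real.pi * I * c) * cexp (-(Real.pi * I * τ / 2 + 2 * Real.pi * I * x)) := by
    intro x
    rw [← Complex.exp_add]
    congr 1
    ring
  have per2 : ∀ x, μ (x + τ/2) = cexp (2 * Real.pi * I * c) * μ x := by
    intro x
    apply huniq
    · rw [show x + τ/2 - c = x - c + τ/2 by ring, bE_tau, bE_tau, (hμ x).2, hexp]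
      ring
    · rw [show x + τ/2 - c = x - c + τ/2 by ring, bO_tau, bO_tau, (hμ x).1, hexp]
      ring
  have hμ0 : μ 0 ≠ 0 := by
    intro h
    have := hμ 0
    rw [h, zero_mul, zero_mul] at this
    exact bv_ne hτ hne _ this.1 this.2
  set ν : ℂ → ℂ := fun x => μ x * cexp (-(4 * Real.pi * I * a * x)) with hν
  have n1 : ∀ x, ν (x + 1/2) = cexp ((-(2 * Real.pi * a) : ℝ) * I) * ν x := by
    intro x
    simp only [hν]
    rw [per1, mul_left_comm, ← Complex.exp_add]
    congr 2
    push_cast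
    ring
  have n2 : ∀ x, ν (x + τ/2) = cexp ((2 * Real.pi * b : ℝ) * I) * ν x := by
    intro x
    simp only [hν]
    rw [per2, mul_right_comm, ← Complex.exp_add, mul_left_comm, ← Complex.exp_add, mul_comm]
    congr 2
    rw [hcdef]
    push_cast
    ring
  have hνd : Differentiable ℂ ν := hdiff.mul (by fun_prop)
  have hb := bel_bounded hτ ν hνd.continuous
    (fun x => by rw [n1, norm_mul, Complex.norm_exp_ofReal_mul_I, one_mul])
    (fun x => by rw [n2, norm_mul, Complex.norm_exp_ofReal_mul_I, one_mul])
  have hν0 : ν 0 ≠ 0 := mul_ne_zero hμ0 (Complex.exp_ne_zero _)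
  have c1 := hνd.apply_eq_apply_of_bounded hb (0 + 1/2) 0
  have c2 := hνd.apply_eq_apply_of_bounded hb (0 + τ/2) 0
  rw [n1] at c1
  rw [n2] at c2
  have d1 := (mul_eq_right₀ hν0).mp c1
  have d2 := (mul_eq_right₀ hν0).mp c2
  rw [Complex.exp_eq_one_iff] at d1 d2
  have hpi : (Real.pi : ℂ) ≠ 0 := by exact_mod_cast Real.pi_ne_zero
  constructor
  · obtain ⟨n, hn⟩ := d1
    refine ⟨-n, ?_⟩
    have h2 : (2 * Real.pi * I) * ((a : ℂ) + n) = 0 := by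
      push_cast at hn
      linear_combination -hn
    have h3 := (mul_eq_zero.mp h2).resolve_left (by simp [hpi])
    have : (a : ℂ) = ((-n : ℤ) : ℝ) := by push_cast; linear_combination h3
    exact_mod_cast this
  · obtain ⟨n, hn⟩ := d2
    refine ⟨n, ?_⟩
    have h2 : (2 * Real.pi * I) * ((b : ℂ) - n) = 0 := by
      push_cast at hn
      linear_combination hn
    have h3 := (mul_eq_zero.mp h2).resolve_left (by simp [hpi])
    have : (b : ℂ) = ((n : ℤ) : ℝ) := by push_cast; linear_combination h3
    exact_mod_cast this

/-- torsion points -/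
def bpt (N : ℕ) (τ : ℂ) (a : ℤ × ℤ) : ℂ := ((a.1 : ℂ) * τ + a.2) / N

/-- coefficient functions with integer labels -/
def bW (N : ℕ) (τ : ℂ) (a : ℤ × ℤ) (z h : ℂ) : ℂ :=
  cexp (2 * Real.pi * I * a.1 * z / N) * bth τ (z + h + bpt N τ a) / bth τ (h + bpt N τ a)

lemma bpt_step2 {N : ℕ} (hN : N ≠ 0) (τ : ℂ) (a b : ℤ) :
    bpt N τ (a, b + N) = bpt N τ (a, b) + 1 := by
  have : (N : ℂ) ≠ 0 := by exact_mod_cast hN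
  simp only [bpt]
  push_cast
  field_simp
  ring

lemma bpt_step1 {N : ℕ} (hN : N ≠ 0) (τ : ℂ) (a b : ℤ) :
    bpt N τ (a + N, b) = bpt N τ (a, b) + τ := by
  have : (N : ℂ) ≠ 0 := by exact_mod_cast hN
  simp only [bpt]
  push_cast
  field_simp
  ring

lemma bel_congr {N : ℕ} {β : Type*} (F : ℤ × ℤ → β) (h1 : ∀ a b, F (a + N, b) = F (a, b))
    (h2 : ∀ a b, F (a, b + N) = F (a, b)) {a b : ℤ × ℤ} (e1 : (N : ℤ) ∣ b.1 - a.1)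
    (e2 : (N : ℤ) ∣ b.2 - a.2) : F b = F a := by
  obtain ⟨a1, a2⟩ := a
  obtain ⟨b1, b2⟩ := b
  obtain ⟨k, hk⟩ := e1
  obtain ⟨l, hl⟩ := e2
  simp only at hk hl
  have p1 : ∀ y, Function.Periodic (fun x => F (x, y)) (N : ℤ) := fun y x => h1 x y
  have p2 : ∀ x, Function.Periodic (fun y => F (x, y)) (N : ℤ) := fun x y => h2 x y
  have q1 := (p1 b2).int_mul k a1
  have q2 := (p2 a1).int_mul l a2
  simp only [Int.cast_id] at q1 q2
  rw [show b1 = a1 + k * N by linear_combination hk, q1,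
    show b2 = a2 + l * N by linear_combination hl, q2]

lemma bW_congr {N : ℕ} (hN : N ≠ 0) (τ z h : ℂ) {a b : ℤ × ℤ} (e1 : (N : ℤ) ∣ b.1 - a.1)
    (e2 : (N : ℤ) ∣ b.2 - a.2) : bW N τ b z h = bW N τ a z h := by
  have hN' : (N : ℂ) ≠ 0 := by exact_mod_cast hN
  refine bel_congr (fun a => bW N τ a z h) ?_ ?_ e1 e2
  · intro a b
    simp only [bW]
    rw [bpt_step1 hN, ← add_assoc, ← add_assoc, bth_add_tau, bth_add_tau, ← mul_assoc]
    have e : cexp (2 * Real.pi * I * ((a + N : ℤ) : ℂ) * z / N) *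
        -cexp (-(Real.pi * I * τ + 2 * Real.pi * I * (z + h + bpt N τ (a, b)))) =
        -cexp (-(Real.pi * I * τ + 2 * Real.pi * I * (h + bpt N τ (a, b)))) *
        cexp (2 * Real.pi * I * a * z / N) := by
      rw [mul_neg, neg_mul, ← Complex.exp_add, ← Complex.exp_add]
      congr 2
      push_cast
      field_simp
      ring
    rw [e, mul_assoc, mul_div_mul_left _ _ (neg_ne_zero.mpr (Complex.exp_ne_zero _))]
  · intro a b
    simp only [bW]
    rw [bpt_step2 hN, ← add_assoc, ← add_assoc, bth_add_one, bth_add_one, mul_neg, neg_div_neg_eq]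

lemma bth_congr {N : ℕ} (hN : N ≠ 0) (τ h : ℂ) {a b : ℤ × ℤ} (e1 : (N : ℤ) ∣ b.1 - a.1)
    (e2 : (N : ℤ) ∣ b.2 - a.2) : (bth τ (h + bpt N τ b) = 0) = (bth τ (h + bpt N τ a) = 0) := by
  refine bel_congr (fun a => (bth τ (h + bpt N τ a) = 0)) ?_ ?_ e1 e2
  · intro a b
    rw [bpt_step1 hN, ← add_assoc, bth_add_tau]
    simp
  · intro a b
    rw [bpt_step2 hN, ← add_assoc, bth_add_one]
    simp

lemma bpt_neg (N : ℕ) (τ : ℂ) (a : ℤ × ℤ) : bpt N τ (-a) = - bpt N τ a := by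
  simp only [bpt, Prod.fst_neg, Prod.snd_neg]
  push_cast
  ring

lemma bpt_add (N : ℕ) (τ : ℂ) (a b : ℤ × ℤ) : bpt N τ (a + b) = bpt N τ a + bpt N τ b := by
  simp only [bpt, Prod.fst_add, Prod.snd_add]
  push_cast
  ring

lemma bW_neg (N : ℕ) (τ z h : ℂ) (a : ℤ × ℤ) : bW N τ (-a) (-z) (-h) = bW N τ a z h := by
  simp only [bW]
  rw [bpt_neg, show -z + -h + -bpt N τ a = -(z + h + bpt N τ a) by ring,
    show -h + -bpt N τ a = -(h + bpt N τ a) by ring, bth_neg, bth_neg, mul_neg, neg_div_neg_eq]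
  congr 3
  simp

lemma bW_zero {N : ℕ} {τ h : ℂ} {a : ℤ × ℤ} (ha : bth τ (h + bpt N τ a) ≠ 0) :
    bW N τ a 0 h = 1 := by
  simp [bW, ha]

lemma bW_fay {N : ℕ} {τ : ℂ} (hτ : 0 < τ.im) (a b : ℤ × ℤ) (x y h h' : ℂ)
    (ha : bth τ (h + bpt N τ a) ≠ 0) (hb : bth τ (h' + bpt N τ b) ≠ 0)
    (hab : bth τ (h + h' + bpt N τ (a + b)) ≠ 0) :
    bth τ y * bW N τ a x h * bW N τ b (x + y) h' =
      bth τ (x + y) * bW N τ b y h' * bW N τ (a + b) x (h + h') -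
      bth τ x * bW N τ (a + b) (x + y) (h + h') * bW N τ (-a) y (-h) := by
  simp only [bW, bpt_neg]
  rw [bpt_add] at hab ⊢
  set q := h + bpt N τ a with hq
  set w := h' + bpt N τ b with hw
  have e0 : h + h' + (bpt N τ a + bpt N τ b) = q + w := by rw [hq, hw]; ring
  have e1 : x + h + bpt N τ a = x + q := by rw [hq]; ring
  have e2 : x + y + h' + bpt N τ b = x + y + w := by rw [hw]; ring
  have e3 : y + h' + bpt N τ b = y + w := by rw [hw]; ring
  have e4 : x + (h + h') + (bpt N τ a + bpt N τ b) = x + w + q := by rw [hq, hw]; ring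
  have e5 : x + y + (h + h') + (bpt N τ a + bpt N τ b) = x + y + q + w := by rw [hq, hw]; ring
  have e6 : y + -h + -bpt N τ a = y - q := by rw [hq]; ring
  have e7 : -h + -bpt N τ a = -q := by rw [hq]; ring
  rw [e0] at hab
  rw [e0, e1, e2, e3, e4, e5, e6, e7, bth_neg]
  have X := bth_weierstrass hτ (x + (y + q + w) / 2) ((y + q + w) / 2) ((w + y - q) / 2)
    ((w - y + q) / 2)
  ring_nf at X
  have X' : bth τ (x + y + q + w) * bth τ x * (bth τ w * bth τ (y - q)) =
      bth τ (x + y + w) * bth τ (x + q) * (bth τ (q + w) * bth τ y) -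
      bth τ (x + w + q) * bth τ (x + y) * (bth τ (y + w) * bth τ q) := by
    ring_nf
    exact X
  have E1 : cexp (2 * Real.pi * I * b.1 * y / N) * cexp (2 * Real.pi * I * (a + b).1 * x / N) =
      cexp (2 * Real.pi * I * a.1 * x / N) * cexp (2 * Real.pi * I * b.1 * (x + y) / N) := by
    rw [← Complex.exp_add, ← Complex.exp_add, Prod.fst_add]
    congr 1
    push_cast
    ring
  have E2 : cexp (2 * Real.pi * I * (a + b).1 * (x + y) / N) *
      cexp (2 * Real.pi * I * (-a).1 * y / N) =
      cexp (2 * Real.pi * I * a.1 * x / N) * cexp (2 * Real.pi * I * b.1 * (x + y) / N) := by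
    rw [← Complex.exp_add, ← Complex.exp_add, Prod.fst_add, Prod.fst_neg]
    congr 1
    push_cast
    ring
  set u1 := cexp (2 * Real.pi * I * b.1 * y / N)
  set u2 := cexp (2 * Real.pi * I * (a + b).1 * x / N)
  set u3 := cexp (2 * Real.pi * I * a.1 * x / N)
  set u4 := cexp (2 * Real.pi * I * b.1 * (x + y) / N)
  set u5 := cexp (2 * Real.pi * I * (a + b).1 * (x + y) / N)
  set u6 := cexp (2 * Real.pi * I * (-a).1 * y / N)
  rw [div_neg]
  field_simp
  linear_combination (-bth τ (x + y) * bth τ (y + w) * bth τ (x + w + q) * bth τ q) * E1 -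
    bth τ x * bth τ (x + y + q + w) * bth τ (y - q) * bth τ w * E2 - u3 * u4 * X'

lemma bW_differentiable {N : ℕ} {τ : ℂ} (hτ : 0 < τ.im) (a : ℤ × ℤ) (h : ℂ) :
    Differentiable ℂ (fun z => bW N τ a z h) := by
  unfold bW
  have : Differentiable ℂ (fun z => bth τ (z + h + bpt N τ a)) :=
    (bth_differentiable hτ).comp (by fun_prop)
  fun_prop

/-- integer representatives -/
def bι {N : ℕ} (a : Fin N × Fin N) : ℤ × ℤ := ((a.1 : ℕ), (a.2 : ℕ))

/-- coefficient functions with labels mod `N` -/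
def bw (N : ℕ) (τ : ℂ) (a : Fin N × Fin N) (z h : ℂ) : ℂ := bW N τ (bι a) z h

lemma fin_add_dvd {N : ℕ} [NeZero N] (a b : Fin N) :
    (N : ℤ) ∣ ((a + b : Fin N) : ℕ) - (((a : ℕ) : ℤ) + ((b : ℕ) : ℤ)) := by
  rw [Fin.val_add]
  push_cast
  exact (Int.modEq_iff_dvd.mp (Int.mod_modEq _ _).symm)

lemma fin_neg_dvd {N : ℕ} [NeZero N] (a : Fin N) :
    (N : ℤ) ∣ ((-a : Fin N) : ℕ) - (-((a : ℕ) : ℤ)) := by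
  have := fin_add_dvd a (-a)
  rw [add_neg_cancel, Fin.val_zero] at this
  obtain ⟨k, hk⟩ := this
  refine ⟨-k, ?_⟩
  push_cast at hk ⊢
  linear_combination -hk

lemma bw_add {N : ℕ} [NeZero N] (τ z h : ℂ) (a b : Fin N × Fin N) :
    bw N τ (a + b) z h = bW N τ (bι a + bι b) z h :=
  bW_congr (NeZero.ne N) τ z h (fin_add_dvd a.1 b.1) (fin_add_dvd a.2 b.2)

lemma bw_neg {N : ℕ} [NeZero N] (τ z h : ℂ) (a : Fin N × Fin N) :
    bw N τ (-a) z h = bW N τ (-bι a) z h :=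
  bW_congr (NeZero.ne N) τ z h (fin_neg_dvd a.1) (fin_neg_dvd a.2)

lemma bw_negneg {N : ℕ} [NeZero N] (τ z h : ℂ) (a : Fin N × Fin N) :
    bw N τ (-a) (-z) (-h) = bw N τ a z h := by
  rw [bw_neg, bW_neg, bw]

lemma bw_fay {N : ℕ} [NeZero N] {τ : ℂ} (hτ : 0 < τ.im) (a b : Fin N × Fin N) (x y h h' : ℂ)
    (ha : bth τ (h + bpt N τ (bι a)) ≠ 0) (hb : bth τ (h' + bpt N τ (bι b)) ≠ 0)
    (hab : bth τ (h + h' + bpt N τ (bι (a + b))) ≠ 0) :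
    bth τ y * bw N τ a x h * bw N τ b (x + y) h' =
      bth τ (x + y) * bw N τ b y h' * bw N τ (a + b) x (h + h') -
      bth τ x * bw N τ (a + b) (x + y) (h + h') * bw N τ (-a) y (-h) := by
  rw [bw_add, bw_add, bw_neg]
  refine bW_fay hτ (bι a) (bι b) x y h h' ha hb ?_
  intro h0
  apply hab
  rwa [bth_congr (NeZero.ne N) τ (h + h') (a := bι a + bι b) (fin_add_dvd a.1 b.1)
    (fin_add_dvd a.2 b.2)]

lemma bpt_ne {N : ℕ} [NeZero N] {τ : ℂ} (hτ : 0 < τ.im) (hne : ∃ u, bth τ u ≠ 0)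
    {γ : Fin N × Fin N} (hγ : γ ≠ 0) : bth τ (bpt N τ (bι γ)) ≠ 0 := by
  intro h0
  have hN : (N : ℝ) ≠ 0 := by exact_mod_cast NeZero.ne N
  have := bth_zeros hτ hne ((γ.1 : ℕ) / N) ((γ.2 : ℕ) / N) (by
    rw [← h0, bpt, bι]
    congr 1
    push_cast
    ring)
  have aux : ∀ k : Fin N, (∃ m : ℤ, ((k : ℕ) : ℝ) / N = m) → k = 0 := by
    rintro k ⟨m, hm⟩
    rw [div_eq_iff hN] at hm
    have h1 : ((k : ℕ) : ℤ) = m * N := by exact_mod_cast hm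
    have h2 : (N : ℤ) ∣ ((k : ℕ) : ℤ) := ⟨m, by rw [h1]; ring⟩
    have h3 : N ∣ (k : ℕ) := by exact_mod_cast h2
    exact Fin.ext (by simpa using Nat.eq_zero_of_dvd_of_lt h3 k.2)
  exact hγ (Prod.ext (aux _ this.1) (aux _ this.2))

lemma bel_sum_diff {ι : Type*} [Fintype ι] (c : ι → ℂ) (f : ι → ℂ → ℂ)
    (hf : ∀ a, Differentiable ℂ (f a)) : Differentiable ℂ (fun t => ∑ a, c a * f a t) :=
  Differentiable.fun_sum fun a _ => (hf a).const_mul (c a)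

/-- the orthogonality relation behind unitarity -/
lemma bw_unit {N : ℕ} [NeZero N] {τ : ℂ} (hτ : 0 < τ.im) (hne : ∃ u, bth τ u ≠ 0) (h : ℂ)
    (hh : ∀ a : Fin N × Fin N, bth τ (h + bpt N τ (bι a)) ≠ 0)
    {γ : Fin N × Fin N} (hγ : γ ≠ 0) (χ : Fin N × Fin N → ℂ) (hχ : ∀ a b, χ (a + b) = χ a * χ b)
    (hχγ : χ γ = 1) (b₀ : Fin N × Fin N) (hb₀ : χ b₀ ≠ 1) (x : ℂ) :
    ∑ a, χ a * (bw N τ a x h * bw N τ (γ - a) x (-h)) = 0 := by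
  have hsum : ∑ a, χ a = 0 := by
    have : ∑ a, χ a = χ b₀ * ∑ a, χ a := by
      rw [Finset.mul_sum]
      refine (Equiv.sum_comp (Equiv.addLeft b₀) χ).symm.trans ?_
      exact Finset.sum_congr rfl fun a _ => hχ b₀ a
    have h2 : (χ b₀ - 1) * ∑ a, χ a = 0 := by linear_combination -this
    exact (mul_eq_zero.mp h2).resolve_left (sub_ne_zero.mpr hb₀)
  set S : ℂ → ℂ := fun t => ∑ a, χ a * bw N τ a t h with hS
  have hS0 : S 0 = 0 := by
    simp only [hS]
    refine Eq.trans ?_ hsum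
    exact Finset.sum_congr rfl fun a _ => by rw [bw, bW_zero (hh a), mul_one]
  have hhneg : ∀ a : Fin N × Fin N, bth τ (-h + bpt N τ (bι a)) ≠ 0 := by
    intro a h0
    have h1 := hh (-a)
    rw [Ne, bth_congr (NeZero.ne N) τ h (a := -bι a) (fin_neg_dvd a.1)
      (fin_neg_dvd a.2), bpt_neg, ← neg_eq_zero, ← bth_neg] at h1
    apply h1
    rw [← h0]
    congr 1
    ring
  set X : ℂ → ℂ := fun t => ∑ a, χ a * (bw N τ a x h * bw N τ (γ - a) (x + t) (-h)) with hX
  set G : ℂ → ℂ := fun t => bth τ (x + t) * bw N τ γ x 0 - bth τ x * bw N τ γ (x + t) 0 with hG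
  have main : ∀ t, bth τ t * X t = S (-t) * G t := by
    intro t
    have A : ∀ a, bth τ t * (χ a * (bw N τ a x h * bw N τ (γ - a) (x + t) (-h))) =
        χ (a - γ) * bw N τ (a - γ) (-t) h * (bth τ (x + t) * bw N τ γ x 0) -
        χ a * bw N τ a (-t) h * (bth τ x * bw N τ γ (x + t) 0) := by
      intro a
      have F := bw_fay hτ a (γ - a) x t h (-h) (hh a) (hhneg _) (by
        rw [add_sub_cancel, add_neg_cancel, zero_add]
        exact bpt_ne hτ hne hγ)
      rw [add_sub_cancel, add_neg_cancel] at F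
      have n1 := bw_negneg τ (-t) h a
      have n2 := bw_negneg τ (-t) h (a - γ)
      rw [neg_neg] at n1 n2
      rw [neg_sub] at n2
      have hχ' : χ (a - γ) = χ a := by
        have := hχ (a - γ) γ
        rw [sub_add_cancel, hχγ, mul_one] at this
        exact this.symm
      rw [← n1, ← n2, hχ']
      linear_combination χ a * F
    simp only [hX]
    rw [Finset.mul_sum, Finset.sum_congr rfl fun a _ => A a, Finset.sum_sub_distrib,
      ← Finset.sum_mul, ← Finset.sum_mul]
    have B : ∑ a, χ (a - γ) * bw N τ (a - γ) (-t) h = S (-t) :=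
      Equiv.sum_comp (Equiv.subRight γ) (fun a => χ a * bw N τ a (-t) h)
    rw [B]
    simp only [hS, hG]
    ring
  have dw : ∀ a k, Differentiable ℂ (fun z => bw N τ a z k) := fun a k => bW_differentiable hτ _ _
  have dth := bth_differentiable hτ
  have dX : DifferentiableAt ℂ X 0 :=
    bel_sum_diff (fun a => χ a) (fun a t => bw N τ a x h * bw N τ (γ - a) (x + t) (-h))
      (fun a => ((dw (γ - a) (-h)).comp (f := fun t => x + t) (by fun_prop)).const_mul _) 0
  have dS : DifferentiableAt ℂ (fun t => S (-t)) 0 :=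
    bel_sum_diff (fun a => χ a) (fun a t => bw N τ a (-t) h)
      (fun a => (dw a h).comp (f := fun t => -t) (by fun_prop)) 0
  have dG : DifferentiableAt ℂ G 0 := by
    have h1 : Differentiable ℂ (fun t => bw N τ γ (x + t) 0) := (dw γ 0).comp (by fun_prop)
    have h2 : Differentiable ℂ (fun t => bth τ (x + t)) := dth.comp (by fun_prop)
    exact ((h2.mul_const _).sub (h1.const_mul _)) 0
  have D1 := (dth 0).hasDerivAt.mul dX.hasDerivAt
  have D2 := dS.hasDerivAt.mul dG.hasDerivAt
  have hfun : (bth τ * X) = ((fun t => S (-t)) * G) := funext main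
  rw [hfun] at D1
  have E := D1.unique D2
  have hG0 : G 0 = 0 := by
    simp only [hG, add_zero]
    ring
  rw [bth_zero, hG0, neg_zero, hS0, zero_mul, mul_zero, zero_mul, add_zero, add_zero] at E
  have := (mul_eq_zero.mp E).resolve_left (bth_deriv_ne hτ hne)
  simpa only [hX, add_zero] using this

/-- the primitive root of unity `ω` -/
def bω (N : ℕ) : ℂ := Complex.exp (2 * Real.pi * Complex.I / N)

lemma bω_prim (N : ℕ) [NeZero N] : IsPrimitiveRoot (bω N) N :=
  Complex.isPrimitiveRoot_exp N (NeZero.ne N)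

lemma bω_ne (N : ℕ) : bω N ≠ 0 := Complex.exp_ne_zero _

lemma bω_pow_mod (N : ℕ) [NeZero N] (k : ℕ) : bω N ^ (k % N) = bω N ^ k := by
  conv_rhs => rw [← Nat.mod_add_div k N, pow_add, pow_mul, (bω_prim N).pow_eq_one, one_pow, mul_one]

lemma bg_entry (N : ℕ) (k : ℕ) :
    eπ (2 * ((k : ℂ) + 1) / N) = bω N ^ (k + 1) := by
  rw [eπ, bω, ← Complex.exp_nat_mul]
  congr 1
  push_cast
  ring

lemma gMat_pow_card (N : ℕ) [NeZero N] : gMat N ^ N = 1 := by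
  rw [gMat, Matrix.diagonal_pow, ← Matrix.diagonal_one]
  congr 1
  funext j
  simp only [Pi.pow_apply]
  rw [bg_entry, ← pow_mul, mul_comm, pow_mul, (bω_prim N).pow_eq_one, one_pow]

lemma hMat_eq (N : ℕ) [NeZero N] :
    hMat N = Matrix.of fun j l => if l = j + 1 then 1 else 0 := by
  ext j l
  simp only [hMat, Matrix.of_apply]
  congr 1
  rw [Fin.ext_iff, Fin.val_add, eq_iff_iff]
  rw [Fin.val_one', Nat.add_mod_mod]

lemma hMat_pow (N : ℕ) [NeZero N] (k : ℕ) :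
    hMat N ^ k = Matrix.of fun j l => if l = j + k • (1 : Fin N) then 1 else 0 := by
  induction k with
  | zero =>
    ext j l
    simp only [pow_zero, Matrix.one_apply, zero_smul, add_zero, Matrix.of_apply, eq_comm]
  | succ k ih =>
    rw [pow_succ, ih, hMat_eq]
    ext j l
    simp only [Matrix.mul_apply, Matrix.of_apply, ite_mul, one_mul, zero_mul,
      Finset.sum_ite_eq', Finset.mem_univ, if_true]
    rw [add_assoc, succ_nsmul]

lemma hMat_pow_card (N : ℕ) [NeZero N] : hMat N ^ N = 1 := by
  rw [hMat_pow]
  have : N • (1 : Fin N) = 0 := by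
    have := card_nsmul_eq_zero' (G := Fin N) (x := 1)
    rwa [Nat.card_eq_fintype_card, Fintype.card_fin] at this
  ext j l
  simp only [this, add_zero, Matrix.of_apply, Matrix.one_apply, eq_comm]

lemma hg_comm (N : ℕ) [NeZero N] : hMat N * gMat N = bω N • (gMat N * hMat N) := by
  rw [hMat_eq, gMat]
  ext j l
  rw [Matrix.smul_apply, Matrix.mul_diagonal, Matrix.diagonal_mul]
  simp only [Matrix.of_apply, smul_eq_mul]
  split_ifs with h
  · rw [one_mul, mul_one, bg_entry, bg_entry, h, Fin.val_add, Fin.val_one', Nat.add_mod_mod,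
      pow_succ, bω_pow_mod]
    ring
  · ring

lemma hg_pow (N : ℕ) [NeZero N] (m n : ℕ) :
    hMat N ^ m * gMat N ^ n = bω N ^ (m * n) • (gMat N ^ n * hMat N ^ m) := by
  have h1 : ∀ n, hMat N * gMat N ^ n = bω N ^ n • (gMat N ^ n * hMat N) := by
    intro n
    induction n with
    | zero => simp
    | succ k ih =>
      rw [pow_succ (gMat N), ← mul_assoc, ih, smul_mul_assoc, mul_assoc, hg_comm, mul_smul_comm,
        smul_smul, ← pow_succ, mul_assoc]
  induction m with
  | zero => simp
  | succ k ih =>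
    rw [pow_succ (hMat N), mul_assoc, h1, mul_smul_comm, ← mul_assoc, ih, smul_mul_assoc, smul_smul,
      mul_assoc, ← pow_add]
    congr 2
    ring

lemma pow_mod_of_card {M : Type*} [Monoid M] {x : M} {N : ℕ} (h : x ^ N = 1) (k : ℕ) :
    x ^ (k % N) = x ^ k := by
  conv_rhs => rw [← Nat.mod_add_div k N, pow_add, pow_mul, h, one_pow, mul_one]

/-- the cocycle -/
def bs {N : ℕ} (a b : Fin N × Fin N) : ℂ := bω N ^ ((a.1 : ℕ) * (b.2 : ℕ))

lemma bs_ne {N : ℕ} (a b : Fin N × Fin N) : bs a b ≠ 0 := pow_ne_zero _ (bω_ne N)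

lemma Imat_mul {N : ℕ} [NeZero N] (a b : Fin N × Fin N) :
    Imat N a * Imat N b = bs a b • Imat N (a + b) := by
  have e1 : gMat N ^ ((a + b).2 : ℕ) = gMat N ^ (a.2 : ℕ) * gMat N ^ (b.2 : ℕ) := by
    rw [← pow_add, Prod.snd_add, Fin.val_add, pow_mod_of_card (gMat_pow_card N)]
  have e2 : hMat N ^ ((a + b).1 : ℕ) = hMat N ^ (a.1 : ℕ) * hMat N ^ (b.1 : ℕ) := by
    rw [← pow_add, Prod.fst_add, Fin.val_add, pow_mod_of_card (hMat_pow_card N)]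
  rw [Imat, Imat, Imat, e1, e2, bs]
  calc _ = gMat N ^ (a.2 : ℕ) * (hMat N ^ (a.1 : ℕ) * gMat N ^ (b.2 : ℕ)) * hMat N ^ (b.1 : ℕ) := by
        simp only [mul_assoc]
    _ = _ := by
        rw [hg_pow]
        simp only [mul_assoc, mul_smul_comm, smul_mul_assoc]

lemma Imat_zero {N : ℕ} [NeZero N] : Imat N 0 = 1 := by
  simp [Imat]

lemma Imat_unit {N : ℕ} [NeZero N] (a : Fin N × Fin N) : IsUnit (Imat N a).det := by
  have h := Imat_mul a (-a)
  rw [add_neg_cancel, Imat_zero] at h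
  have h2 : Imat N a * ((bs a (-a))⁻¹ • Imat N (-a)) = 1 := by
    rw [mul_smul_comm, h, smul_smul, inv_mul_cancel₀ (bs_ne _ _), one_smul]
  have h3 := congrArg Matrix.det h2
  rw [Matrix.det_mul, Matrix.det_one] at h3
  exact IsUnit.of_mul_eq_one _ h3

lemma bs_add_left {N : ℕ} [NeZero N] (a b c : Fin N × Fin N) : bs (a + b) c = bs a c * bs b c := by
  rw [bs, bs, bs, ← pow_add, ← add_mul, Prod.fst_add, Fin.val_add, pow_mul, bω_pow_mod, ← pow_mul]

lemma bs_add_right {N : ℕ} [NeZero N] (a b c : Fin N × Fin N) : bs a (b + c) = bs a b * bs a c := by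
  rw [bs, bs, bs, ← pow_add, ← mul_add, Prod.snd_add, Fin.val_add, mul_comm, pow_mul, bω_pow_mod,
    ← pow_mul, mul_comm]

/-- the commutator pairing -/
def bc {N : ℕ} (a b : Fin N × Fin N) : ℂ := bs a b / bs b a

lemma bc_add_left {N : ℕ} [NeZero N] (a b c : Fin N × Fin N) : bc (a + b) c = bc a c * bc b c := by
  rw [bc, bc, bc, bs_add_left, bs_add_right, mul_div_mul_comm]

lemma bc_add_right {N : ℕ} [NeZero N] (a b c : Fin N × Fin N) : bc a (b + c) = bc a b * bc a c := by
  rw [bc, bc, bc, bs_add_left, bs_add_right, mul_div_mul_comm]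

lemma bc_self {N : ℕ} (a : Fin N × Fin N) : bc a a = 1 := div_self (bs_ne _ _)

lemma bc_inv {N : ℕ} (a b : Fin N × Fin N) : bc a b = (bc b a)⁻¹ := by
  rw [bc, bc, inv_div]

lemma bc_nontriv {N : ℕ} [NeZero N] (hN : 2 ≤ N) {γ : Fin N × Fin N} (hγ : γ ≠ 0) :
    ∃ b, bc b γ ≠ 1 := by
  have h1 : ((1 : Fin N) : ℕ) = 1 := by rw [Fin.val_one', Nat.mod_eq_of_lt (by omega)]
  have key : ∀ k : Fin N, bω N ^ (k : ℕ) = 1 → k = 0 := by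
    intro k hk
    have h3 := (bω_prim N).dvd_of_pow_eq_one _ hk
    exact Fin.ext (by simpa using Nat.eq_zero_of_dvd_of_lt h3 k.2)
  by_contra hcon
  push Not at hcon
  apply hγ
  have A := hcon (1, 0)
  have B := hcon (0, 1)
  simp only [bc, bs, h1, Fin.val_zero, mul_zero, zero_mul, one_mul, mul_one, pow_zero, div_one,
    one_div, inv_eq_one] at A B
  exact Prod.ext (key _ (by simpa using B)) (key _ (by simpa using A))

/-- `M ⊗ M⁻¹` -/
def bY {N : ℕ} (M : Matrix (Fin N) (Fin N) ℂ) : Matrix (Fin N × Fin N) (Fin N × Fin N) ℂ := M ⊗ₖ M⁻¹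

lemma binv_smul {N : ℕ} {c : ℂ} (hc : c ≠ 0) (M : Matrix (Fin N) (Fin N) ℂ) (hM : IsUnit M.det) :
    (c • M)⁻¹ = c⁻¹ • M⁻¹ := by
  apply Matrix.inv_eq_right_inv
  rw [smul_mul_smul_comm, Matrix.mul_nonsing_inv _ hM, mul_inv_cancel₀ hc, one_smul]

lemma bY_smul {N : ℕ} {c : ℂ} (hc : c ≠ 0) (M : Matrix (Fin N) (Fin N) ℂ) (hM : IsUnit M.det) :
    bY (c • M) = bY M := by
  rw [bY, bY, binv_smul hc M hM, Matrix.smul_kronecker, Matrix.kronecker_smul, smul_smul,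
    mul_inv_cancel₀ hc, one_smul]

lemma bY_add {N : ℕ} [NeZero N] (a b : Fin N × Fin N) :
    bY (Imat N (a + b)) = (Imat N a * Imat N b) ⊗ₖ ((Imat N b)⁻¹ * (Imat N a)⁻¹) := by
  rw [← bY_smul (bs_ne a b) _ (Imat_unit _), ← Imat_mul, bY, Matrix.mul_inv_rev]

lemma bY_neg {N : ℕ} [NeZero N] (a : Fin N × Fin N) :
    bY (Imat N (-a)) = (Imat N a)⁻¹ ⊗ₖ Imat N a := by
  have h : Imat N (-a) = bs a (-a) • (Imat N a)⁻¹ := by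
    have h := Imat_mul a (-a)
    rw [add_neg_cancel, Imat_zero] at h
    have h2 := congrArg (fun M => (Imat N a)⁻¹ * M) h
    simp only [← mul_assoc, Matrix.nonsing_inv_mul _ (Imat_unit a), one_mul, mul_smul_comm,
      mul_one] at h2
    exact h2
  rw [h, bY_smul (bs_ne _ _) _ (Matrix.isUnit_nonsing_inv_det _ (Imat_unit a)), bY,
    Matrix.nonsing_inv_nonsing_inv _ (Imat_unit a)]

lemma bY_mul {N : ℕ} [NeZero N] (a b : Fin N × Fin N) :
    bY (Imat N a) * bY (Imat N b) = bc a b • bY (Imat N (a + b)) := by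
  rw [bY, bY, bY, ← Matrix.mul_kronecker_mul, ← Matrix.mul_inv_rev, Imat_mul, Imat_mul,
    binv_smul (bs_ne _ _) _ (Imat_unit _), Matrix.smul_kronecker, Matrix.kronecker_smul, smul_smul,
    add_comm b a, bc, div_eq_mul_inv]

lemma R12_kron {N : ℕ} (A B : Matrix (Fin N) (Fin N) ℂ) :
    R12of N (A ⊗ₖ B) = A ⊗ₖ (B ⊗ₖ (1 : Matrix (Fin N) (Fin N) ℂ)) := by
  ext a b
  simp [R12of, Matrix.kroneckerMap_apply, Matrix.one_apply]

lemma R13_kron {N : ℕ} (A B : Matrix (Fin N) (Fin N) ℂ) :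
    R13of N (A ⊗ₖ B) = A ⊗ₖ ((1 : Matrix (Fin N) (Fin N) ℂ) ⊗ₖ B) := by
  ext a b
  simp [R13of, Matrix.kroneckerMap_apply, Matrix.one_apply]

lemma R23_kron {N : ℕ} (A B : Matrix (Fin N) (Fin N) ℂ) :
    R23of N (A ⊗ₖ B) = (1 : Matrix (Fin N) (Fin N) ℂ) ⊗ₖ (A ⊗ₖ B) := by
  ext a b
  simp [R23of, Matrix.kroneckerMap_apply, Matrix.one_apply]

/-- basis elements on the triple product -/
def bX12 {N : ℕ} (a : Fin N × Fin N) := R12of N (bY (Imat N a))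
def bX13 {N : ℕ} (a : Fin N × Fin N) := R13of N (bY (Imat N a))
def bX23 {N : ℕ} (a : Fin N × Fin N) := R23of N (bY (Imat N a))

lemma bX_rel1 {N : ℕ} [NeZero N] (a b : Fin N × Fin N) :
    bX12 a * bX13 b = bX23 b * bX12 (a + b) := by
  rw [bX12, bX13, bX23, bX12, bY_add, bY, bY, R12_kron, R12_kron, R13_kron, R23_kron]
  simp only [← Matrix.mul_kronecker_mul, one_mul, mul_one, ← mul_assoc,
    Matrix.mul_nonsing_inv _ (Imat_unit _)]

lemma bX_rel2 {N : ℕ} [NeZero N] (a b : Fin N × Fin N) :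
    bX12 a * bX13 b = bX13 (a + b) * bX23 (-a) := by
  rw [bX12, bX13, bX23, bX13, bY_add, bY_neg, bY, bY, R12_kron, R13_kron, R13_kron, R23_kron]
  simp only [← Matrix.mul_kronecker_mul, one_mul, mul_one, mul_assoc,
    Matrix.nonsing_inv_mul _ (Imat_unit _)]

lemma bX_rel3 {N : ℕ} [NeZero N] (a b : Fin N × Fin N) :
    bX13 b * bX12 a = bX12 (a + b) * bX23 b := by
  rw [add_comm a b, bX12, bX13, bX23, bX12, bY_add, bY, bY, R12_kron, R12_kron, R13_kron, R23_kron]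
  simp only [← Matrix.mul_kronecker_mul, one_mul, mul_one, mul_assoc,
    Matrix.nonsing_inv_mul _ (Imat_unit _)]

lemma bX_rel4 {N : ℕ} [NeZero N] (a b : Fin N × Fin N) :
    bX13 b * bX12 a = bX23 (-a) * bX13 (a + b) := by
  rw [add_comm a b, bX12, bX13, bX23, bX13, bY_add, bY_neg, bY, bY, R12_kron, R13_kron, R13_kron,
    R23_kron]
  simp only [← Matrix.mul_kronecker_mul, one_mul, mul_one, ← mul_assoc,
    Matrix.mul_nonsing_inv _ (Imat_unit _)]

lemma R12_eq {N : ℕ} (M : Matrix (Fin N × Fin N) (Fin N × Fin N) ℂ) :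
    R12of N M = (M ⊗ₖ (1 : Matrix (Fin N) (Fin N) ℂ)).submatrix
      (Equiv.prodAssoc _ _ _).symm (Equiv.prodAssoc _ _ _).symm := by
  ext a b
  simp [R12of, Matrix.kroneckerMap_apply, Matrix.one_apply]

lemma R23_eq {N : ℕ} (M : Matrix (Fin N × Fin N) (Fin N × Fin N) ℂ) :
    R23of N M = (1 : Matrix (Fin N) (Fin N) ℂ) ⊗ₖ M := by
  ext a b
  simp [R23of, Matrix.kroneckerMap_apply, Matrix.one_apply]

/-- swap of the last two factors -/
def bsw (N : ℕ) : Fin N × Fin N × Fin N ≃ Fin N × Fin N × Fin N :=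
  (Equiv.refl (Fin N)).prodCongr (Equiv.prodComm _ _)

lemma R13_eq {N : ℕ} (M : Matrix (Fin N × Fin N) (Fin N × Fin N) ℂ) :
    R13of N M = (R12of N M).submatrix (bsw N) (bsw N) := by
  ext a b
  simp [R13of, R12of, bsw]

lemma R12_mul {N : ℕ} (A B : Matrix (Fin N × Fin N) (Fin N × Fin N) ℂ) :
    R12of N (A * B) = R12of N A * R12of N B := by
  rw [R12_eq, R12_eq, R12_eq, Matrix.submatrix_mul_equiv, ← Matrix.mul_kronecker_mul, one_mul]

lemma R13_mul {N : ℕ} (A B : Matrix (Fin N × Fin N) (Fin N × Fin N) ℂ) :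
    R13of N (A * B) = R13of N A * R13of N B := by
  rw [R13_eq, R13_eq, R13_eq, R12_mul, Matrix.submatrix_mul_equiv]

lemma R23_mul {N : ℕ} (A B : Matrix (Fin N × Fin N) (Fin N × Fin N) ℂ) :
    R23of N (A * B) = R23of N A * R23of N B := by
  rw [R23_eq, R23_eq, R23_eq, ← Matrix.mul_kronecker_mul, one_mul]

lemma R12_lin {N : ℕ} {ι : Type*} (s : Finset ι) (c : ι → ℂ)
    (M : ι → Matrix (Fin N × Fin N) (Fin N × Fin N) ℂ) :
    R12of N (∑ i ∈ s, c i • M i) = ∑ i ∈ s, c i • R12of N (M i) := by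
  ext a b
  simp only [R12of, Matrix.of_apply, Matrix.sum_apply, Matrix.smul_apply, smul_eq_mul,
    Finset.sum_mul, mul_assoc]

lemma R13_lin {N : ℕ} {ι : Type*} (s : Finset ι) (c : ι → ℂ)
    (M : ι → Matrix (Fin N × Fin N) (Fin N × Fin N) ℂ) :
    R13of N (∑ i ∈ s, c i • M i) = ∑ i ∈ s, c i • R13of N (M i) := by
  ext a b
  simp only [R13of, Matrix.of_apply, Matrix.sum_apply, Matrix.smul_apply, smul_eq_mul,
    Finset.sum_mul, mul_assoc]

lemma R23_lin {N : ℕ} {ι : Type*} (s : Finset ι) (c : ι → ℂ)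
    (M : ι → Matrix (Fin N × Fin N) (Fin N × Fin N) ℂ) :
    R23of N (∑ i ∈ s, c i • M i) = ∑ i ∈ s, c i • R23of N (M i) := by
  ext a b
  simp only [R23of, Matrix.of_apply, Matrix.sum_apply, Matrix.smul_apply, smul_eq_mul,
    Finset.sum_mul, mul_assoc]

lemma bX23_mul {N : ℕ} [NeZero N] (a b : Fin N × Fin N) :
    (bX23 a * bX23 b : Matrix _ _ ℂ) = bc a b • bX23 (a + b) := by
  rw [bX23, bX23, bX23, ← R23_mul, bY_mul, R23_eq, R23_eq, Matrix.kronecker_smul]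

lemma bel_sum1 {ι M : Type*} [Fintype ι] [AddCommGroup ι] [AddCommMonoid M] (F : ι → ι → M) :
    ∑ a, ∑ b, F b (a + b) = ∑ b, ∑ c, F b c := by
  rw [Finset.sum_comm]
  exact Finset.sum_congr rfl fun b _ => Equiv.sum_comp (Equiv.addRight b) (F b)

lemma bel_sum2 {ι M : Type*} [Fintype ι] [AddCommGroup ι] [AddCommMonoid M] (F : ι → ι → M) :
    ∑ a, ∑ b, F (a + b) (-a) = ∑ b, ∑ c, F b c := by
  rw [Finset.sum_comm (f := fun b c => F b c)]
  rw [← Equiv.sum_comp (Equiv.neg ι) (fun c => ∑ b, F b c)]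
  exact Finset.sum_congr rfl fun a _ => Equiv.sum_comp (Equiv.addLeft a) (fun c => F c (-a))

/-- the un-normalised operator -/
def bR {N : ℕ} (τ : ℂ)
    (X : Fin N × Fin N → Matrix (Fin N × Fin N × Fin N) (Fin N × Fin N × Fin N) ℂ) (z h : ℂ) :
    Matrix (Fin N × Fin N × Fin N) (Fin N × Fin N × Fin N) ℂ :=
  ∑ a, bw N τ a z h • X a

lemma bR_mul {N : ℕ} (τ : ℂ)
    (X X' : Fin N × Fin N → Matrix (Fin N × Fin N × Fin N) (Fin N × Fin N × Fin N) ℂ)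
    (z h z' h' : ℂ) : bR τ X z h * bR τ X' z' h' =
      ∑ a, ∑ b, (bw N τ a z h * bw N τ b z' h') • (X a * X' b) := by
  rw [bR, bR, Finset.sum_mul_sum]
  exact Finset.sum_congr rfl fun a _ => Finset.sum_congr rfl fun b _ => smul_mul_smul_comm _ _ _ _

lemma bR_rel_i {N : ℕ} [NeZero N] {τ : ℂ} (hτ : 0 < τ.im) (x y h : ℂ)
    (h1 : ∀ a : Fin N × Fin N, bth τ (h + bpt N τ (bι a)) ≠ 0)
    (h2 : ∀ a : Fin N × Fin N, bth τ (h + h + bpt N τ (bι a)) ≠ 0) :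
    bth τ y • (bR τ bX12 x h * bR τ bX13 (x + y) h) =
      bth τ (x + y) • (bR τ bX23 y h * bR (N := N) τ bX12 x (h + h)) -
      bth τ x • (bR τ bX13 (x + y) (h + h) * bR τ bX23 y (-h)) := by
  rw [bR_mul, bR_mul, bR_mul,
    ← bel_sum1 (fun b c => (bw N τ b y h * bw N τ c x (h + h)) • (bX23 b * bX12 c)),
    ← bel_sum2 (fun b c => (bw N τ b (x + y) (h + h) * bw N τ c y (-h)) • (bX13 b * bX23 c)),
    Finset.smul_sum, Finset.smul_sum, Finset.smul_sum, ← Finset.sum_sub_distrib]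
  refine Finset.sum_congr rfl fun a _ => ?_
  rw [Finset.smul_sum, Finset.smul_sum, Finset.smul_sum, ← Finset.sum_sub_distrib]
  refine Finset.sum_congr rfl fun b _ => ?_
  rw [← bX_rel1, ← bX_rel2, smul_smul, smul_smul, smul_smul, ← sub_smul]
  congr 1
  linear_combination bw_fay hτ a b x y h h (h1 a) (h1 b) (h2 _)

lemma bR_rel_ii {N : ℕ} [NeZero N] {τ : ℂ} (hτ : 0 < τ.im) (x y h : ℂ)
    (h1 : ∀ a : Fin N × Fin N, bth τ (h + bpt N τ (bι a)) ≠ 0)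
    (h2 : ∀ a : Fin N × Fin N, bth τ (h + h + bpt N τ (bι a)) ≠ 0) :
    bth τ y • (bR τ bX13 (x + y) h * bR τ bX12 x h) =
      bth τ (x + y) • (bR (N := N) τ bX12 x (h + h) * bR τ bX23 y h) -
      bth τ x • (bR τ bX23 y (-h) * bR τ bX13 (x + y) (h + h)) := by
  rw [bR_mul, bR_mul, bR_mul, Finset.sum_comm, Finset.sum_comm (f := fun a b =>
      (bw N τ a x (h + h) * bw N τ b y h) • (bX12 a * bX23 b)), Finset.sum_comm (f := fun a b =>
      (bw N τ a y (-h) * bw N τ b (x + y) (h + h)) • (bX23 a * bX13 b)),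
    ← bel_sum1 (fun b c => (bw N τ c x (h + h) * bw N τ b y h) • (bX12 c * bX23 b)),
    ← bel_sum2 (fun b c => (bw N τ c y (-h) * bw N τ b (x + y) (h + h)) • (bX23 c * bX13 b)),
    Finset.smul_sum, Finset.smul_sum, Finset.smul_sum, ← Finset.sum_sub_distrib]
  refine Finset.sum_congr rfl fun a _ => ?_
  rw [Finset.smul_sum, Finset.smul_sum, Finset.smul_sum, ← Finset.sum_sub_distrib]
  refine Finset.sum_congr rfl fun b _ => ?_
  rw [← bX_rel3, ← bX_rel4, smul_smul, smul_smul, smul_smul, ← sub_smul]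
  congr 1
  linear_combination bw_fay hτ a b x y h h (h1 a) (h1 b) (h2 _)

lemma bX23_zero {N : ℕ} [NeZero N] : (bX23 0 : Matrix _ _ ℂ) = (1 : Matrix (Fin N × Fin N × Fin N) _ ℂ) := by
  rw [bX23, Imat_zero, bY, inv_one, R23_kron, Matrix.one_kronecker_one, Matrix.one_kronecker_one]

lemma bR_unit1 {N : ℕ} [NeZero N] (hN : 2 ≤ N) {τ : ℂ} (hτ : 0 < τ.im) (hne : ∃ u, bth τ u ≠ 0)
    (y h : ℂ) (h1 : ∀ a : Fin N × Fin N, bth τ (h + bpt N τ (bι a)) ≠ 0) :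
    bR τ bX23 y h * bR τ bX23 y (-h) =
      (∑ a, bw N τ a y h * bw N τ (-a) y (-h)) • (1 : Matrix (Fin N × Fin N × Fin N) _ ℂ) := by
  rw [bR_mul]
  have e : ∀ a : Fin N × Fin N, ∑ b, (bw N τ a y h * bw N τ b y (-h)) • (bX23 a * bX23 b) =
      ∑ γ, (bc a γ * (bw N τ a y h * bw N τ (γ - a) y (-h))) •
        (bX23 γ : Matrix (Fin N × Fin N × Fin N) _ ℂ) := by
    intro a
    rw [← Equiv.sum_comp (Equiv.addLeft a) (fun γ => (bc a γ * (bw N τ a y h *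
      bw N τ (γ - a) y (-h))) • (bX23 γ : Matrix (Fin N × Fin N × Fin N) _ ℂ))]
    refine Finset.sum_congr rfl fun b _ => ?_
    rw [bX23_mul, smul_smul, Equiv.coe_addLeft, add_sub_cancel_left, bc_add_right, bc_self, one_mul,
      mul_comm]
  rw [Finset.sum_congr rfl fun a _ => e a, Finset.sum_comm, Finset.sum_eq_single 0]
  · rw [← Finset.sum_smul, bX23_zero]
    congr 1
    refine Finset.sum_congr rfl fun a _ => ?_
    have : bc a (0 : Fin N × Fin N) = 1 := by
      have := bc_add_right a 0 0
      rw [add_zero] at this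
      have h0 : bc a (0 : Fin N × Fin N) ≠ 0 := div_ne_zero (bs_ne _ _) (bs_ne _ _)
      exact (mul_left_cancel₀ h0 (by rw [mul_one]; exact this)).symm
    rw [this, one_mul, zero_sub]
  · intro γ _ hγ
    obtain ⟨b₀, hb₀⟩ := bc_nontriv hN hγ
    rw [← Finset.sum_smul, bw_unit hτ hne h h1 hγ (fun a => bc a γ)
      (fun a b => bc_add_left a b γ) (bc_self γ) b₀ hb₀, zero_smul]
  · intro h0
    exact absurd (Finset.mem_univ _) h0

lemma bR_unit2 {N : ℕ} [NeZero N] (hN : 2 ≤ N) {τ : ℂ} (hτ : 0 < τ.im) (hne : ∃ u, bth τ u ≠ 0)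
    (y h : ℂ) (h1 : ∀ a : Fin N × Fin N, bth τ (h + bpt N τ (bι a)) ≠ 0) :
    bR τ bX23 y (-h) * bR τ bX23 y h =
      (∑ a, bw N τ a y h * bw N τ (-a) y (-h)) • (1 : Matrix (Fin N × Fin N × Fin N) _ ℂ) := by
  rw [bR_mul, Finset.sum_comm]
  have e : ∀ a : Fin N × Fin N, ∑ b, (bw N τ b y (-h) * bw N τ a y h) • (bX23 b * bX23 a) =
      ∑ γ, (bc γ a * (bw N τ a y h * bw N τ (γ - a) y (-h))) •
        (bX23 γ : Matrix (Fin N × Fin N × Fin N) _ ℂ) := by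
    intro a
    rw [← Equiv.sum_comp (Equiv.addLeft a) (fun γ => (bc γ a * (bw N τ a y h *
      bw N τ (γ - a) y (-h))) • (bX23 γ : Matrix (Fin N × Fin N × Fin N) _ ℂ))]
    refine Finset.sum_congr rfl fun b _ => ?_
    rw [bX23_mul, smul_smul, Equiv.coe_addLeft, add_sub_cancel_left, bc_add_left, bc_self, one_mul,
      add_comm b a]
    congr 1
    ring
  rw [Finset.sum_congr rfl fun a _ => e a, Finset.sum_comm, Finset.sum_eq_single 0]
  · rw [← Finset.sum_smul, bX23_zero]
    congr 1
    refine Finset.sum_congr rfl fun a _ => ?_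
    have : bc (0 : Fin N × Fin N) a = 1 := by
      have := bc_add_left 0 0 a
      rw [add_zero] at this
      have h0 : bc (0 : Fin N × Fin N) a ≠ 0 := div_ne_zero (bs_ne _ _) (bs_ne _ _)
      exact (mul_left_cancel₀ h0 (by rw [mul_one]; exact this)).symm
    rw [this, one_mul, zero_sub]
  · intro γ _ hγ
    obtain ⟨b₀, hb₀⟩ := bc_nontriv hN hγ
    rw [← Finset.sum_smul, bw_unit hτ hne h h1 hγ (fun a => bc γ a)
      (fun a b => bc_add_right γ a b) (bc_self γ) b₀ (by
        intro h0
        apply hb₀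
        rw [bc_inv, h0, inv_one]), zero_smul]
  · intro h0
    exact absurd (Finset.mem_univ _) h0

lemma bR_ybe_generic {N : ℕ} [NeZero N] (hN : 2 ≤ N) {τ : ℂ} (hτ : 0 < τ.im)
    (hne : ∃ u, bth τ u ≠ 0) (x y h : ℂ) (hy : bth τ y ≠ 0)
    (h1 : ∀ a : Fin N × Fin N, bth τ (h + bpt N τ (bι a)) ≠ 0)
    (h2 : ∀ a : Fin N × Fin N, bth τ (h + h + bpt N τ (bι a)) ≠ 0) :
    bR τ bX12 x h * bR τ bX13 (x + y) h * bR τ bX23 y h =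
      bR (N := N) τ bX23 y h * bR τ bX13 (x + y) h * bR τ bX12 x h := by
  have A := congrArg (fun M => M * bR τ bX23 y h) (bR_rel_i hτ x y h h1 h2)
  have B := congrArg (fun M => bR τ bX23 y h * M) (bR_rel_ii hτ x y h h1 h2)
  have U1 := bR_unit1 hN hτ hne y h h1
  have U2 := bR_unit2 hN hτ hne y h h1
  simp only [sub_mul, mul_sub, smul_mul_assoc, mul_smul_comm] at A B
  rw [mul_assoc (bR τ bX13 (x + y) (h + h)), U2, mul_smul_comm, mul_one] at A
  rw [← mul_assoc (bR τ bX23 y h) (bR τ bX23 y (-h)), U1, smul_mul_assoc, one_mul,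
    ← mul_assoc, ← mul_assoc] at B
  exact smul_right_injective _ hy (A.trans B.symm)

lemma bw_contAt {N : ℕ} {τ : ℂ} (hτ : 0 < τ.im) (a : Fin N × Fin N) {f g : ℂ → ℂ}
    (hf : Continuous f) (hg : Continuous g) (h : bth τ (g 0 + bpt N τ (bι a)) ≠ 0) :
    ContinuousAt (fun t => bw N τ a (f t) (g t)) 0 := by
  have hb := (bth_differentiable hτ).continuous
  unfold bw bW
  refine ContinuousAt.div ?_ ?_ h
  · refine Continuous.continuousAt ?_
    refine Continuous.mul (by fun_prop) (hb.comp (by fun_prop))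
  · exact (hb.comp (by fun_prop : Continuous fun t => g t + bpt N τ (bι a))).continuousAt

lemma bR_contAt {N : ℕ} {τ : ℂ} (hτ : 0 < τ.im)
    (X : Fin N × Fin N → Matrix (Fin N × Fin N × Fin N) (Fin N × Fin N × Fin N) ℂ) {f g : ℂ → ℂ}
    (hf : Continuous f) (hg : Continuous g)
    (h : ∀ a : Fin N × Fin N, bth τ (g 0 + bpt N τ (bι a)) ≠ 0) :
    ContinuousAt (fun t => bR τ X (f t) (g t)) 0 := by
  unfold bR
  exact tendsto_finsetSum _ fun a _ => (bw_contAt hτ a hf hg (h a)).smul continuousAt_const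

open Filter Topology in
lemma bR_ybe {N : ℕ} [NeZero N] (hN : 2 ≤ N) {τ : ℂ} (hτ : 0 < τ.im)
    (hne : ∃ u, bth τ u ≠ 0) (x y h : ℂ)
    (h1 : ∀ a : Fin N × Fin N, bth τ (h + bpt N τ (bι a)) ≠ 0) :
    bR τ bX12 x h * bR τ bX13 (x + y) h * bR τ bX23 y h =
      bR (N := N) τ bX23 y h * bR τ bX13 (x + y) h * bR τ bX12 x h := by
  have h1' : ∀ a : Fin N × Fin N, bth τ ((h + (0 : ℂ)) + bpt N τ (bι a)) ≠ 0 := by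
    simpa only [add_zero] using h1
  have c12 := bR_contAt hτ (bX12 (N := N)) (f := fun _ => x) (g := fun t => h + t) (by fun_prop)
    (by fun_prop) h1'
  have c13 := bR_contAt hτ (bX13 (N := N)) (f := fun t => x + (y + t)) (g := fun t => h + t)
    (by fun_prop) (by fun_prop) h1'
  have c23 := bR_contAt hτ (bX23 (N := N)) (f := fun t => y + t) (g := fun t => h + t)
    (by fun_prop) (by fun_prop) h1'
  have cL := (c12.mul c13).mul c23
  have cR := (c23.mul c13).mul c12
  have cL' := cL.tendsto.mono_left (nhdsWithin_le_nhds (s := {(0 : ℂ)}ᶜ))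
  have cR' := cR.tendsto.mono_left (nhdsWithin_le_nhds (s := {(0 : ℂ)}ᶜ))
  have e1 : ∀ᶠ t in 𝓝[≠] (0 : ℂ), bth τ (y + t) ≠ 0 :=
    (bth_ev hτ hne one_ne_zero y 0).mono fun t ht => by rwa [one_mul, add_comm] at ht
  have e2 : ∀ᶠ t in 𝓝[≠] (0 : ℂ), ∀ a : Fin N × Fin N, bth τ (h + t + bpt N τ (bι a)) ≠ 0 :=
    eventually_all.mpr fun a => (bth_ev hτ hne one_ne_zero (h + bpt N τ (bι a)) 0).mono
      fun t ht => by
        convert ht using 2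
        ring
  have e3 : ∀ᶠ t in 𝓝[≠] (0 : ℂ), ∀ a : Fin N × Fin N,
      bth τ (h + t + (h + t) + bpt N τ (bι a)) ≠ 0 :=
    eventually_all.mpr fun a => (bth_ev hτ hne two_ne_zero (2 * h + bpt N τ (bι a)) 0).mono
      fun t ht => by
        convert ht using 2
        ring
  have ev := (e1.and (e2.and e3)).mono fun t ht =>
    bR_ybe_generic hN hτ hne x (y + t) (h + t) ht.1 ht.2.1 ht.2.2
  have key := tendsto_nhds_unique (cL'.congr' ev) cR'
  simpa only [add_zero, Pi.mul_apply] using key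

lemma bel_jTheta_pt {N : ℕ} (a : Fin N × Fin N) (u τ : ℂ) :
    jTheta (1/2 + (a.1 : ℕ) / N) (1/2 + (a.2 : ℕ) / N) u τ =
      cexp (Real.pi * I * ((a.1 : ℕ) / N) ^ 2 * τ + 2 * Real.pi * I * ((a.1 : ℕ) / N) *
        (1 / 2 + (a.2 : ℕ) / N)) * cexp (2 * Real.pi * I * ((a.1 : ℕ) / N) * u) *
        bth τ (u + bpt N τ (bι a)) := by
  rw [bel_jTheta_shift, ← Complex.exp_add]
  congr 1
  · congr 1
    push_cast
    ring
  · congr 1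
    rw [bpt, bι]
    push_cast
    ring

lemma Wcoef_eq {N : ℕ} (a : Fin N × Fin N) (ξ ζ τ : ℂ) :
    Wcoef N a ξ ζ τ = (1 / (N : ℂ)) * bw N τ a ξ (ζ / N) := by
  rw [Wcoef, bel_jTheta_pt, bel_jTheta_pt, bw, bW]
  have e : cexp (2 * Real.pi * I * ((a.1 : ℕ) / N) * (ξ + ζ / N)) =
      cexp (2 * Real.pi * I * ((bι a).1 : ℤ) * ξ / N) *
        cexp (2 * Real.pi * I * ((a.1 : ℕ) / N) * (ζ / N)) := by
    rw [← Complex.exp_add]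
    congr 1
    rw [bι]
    push_cast
    ring
  rw [e]
  have n1 := Complex.exp_ne_zero (Real.pi * I * ((a.1 : ℕ) / N) ^ 2 * τ +
    2 * Real.pi * I * ((a.1 : ℕ) / N) * (1 / 2 + (a.2 : ℕ) / N))
  have n2 := Complex.exp_ne_zero (2 * Real.pi * I * ((a.1 : ℕ) / N) * (ζ / N))
  generalize cexp (Real.pi * I * ((a.1 : ℕ) / N) ^ 2 * τ +
    2 * Real.pi * I * ((a.1 : ℕ) / N) * (1 / 2 + (a.2 : ℕ) / N)) = A at *
  generalize cexp (2 * Real.pi * I * ((a.1 : ℕ) / N) * (ζ / N)) = B at *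
  rw [show ∀ p q r s n : ℂ, A * (p * B) * q / (n * (A * B * r)) = (A * B) * (p * q) / ((A * B) * (n * r))
    from fun p q r s n => by ring_nf, mul_div_mul_left _ _ (mul_ne_zero n1 n2)]
  · rw [show (1 : ℂ) / N = (N : ℂ)⁻¹ from one_div _, div_eq_mul_inv, mul_inv, div_eq_mul_inv]
    ring
  · exact 0

/-- the scalar prefactor -/
def bK (N : ℕ) (ξ ζ τ : ℂ) : ℂ :=
  (eπ (ξ * (2 / N - 2)) * (kappaNum N ξ ζ τ / kappaDen N ξ ζ τ) *
      jTheta (1/2) (1/2) ζ τ / jTheta (1/2) (1/2) (ξ + ζ) τ) * (1 / (N : ℂ))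

lemma Zmat_eq {N : ℕ} (ξ ζ τ : ℂ) :
    Zmat N ξ ζ τ = ∑ a, (bK N ξ ζ τ * bw N τ a ξ (ζ / N)) • bY (Imat N a) := by
  rw [Zmat, Finset.smul_sum]
  refine Finset.sum_congr rfl fun a _ => ?_
  rw [Wcoef_eq, smul_smul, bK, bY, mul_assoc _ (1 / (N : ℂ))]

lemma gHalf_unit (N : ℕ) : IsUnit (gHalf N).det := by
  rw [gHalf, Matrix.det_diagonal, isUnit_iff_ne_zero]
  exact Finset.prod_ne_zero_iff.mpr fun j _ => Complex.exp_ne_zero _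

/-- the gauge transformation on three factors, and its inverse -/
def bG (N : ℕ) := gHalf N ⊗ₖ (gHalf N ⊗ₖ gHalf N)
def bGi (N : ℕ) := (gHalf N)⁻¹ ⊗ₖ ((gHalf N)⁻¹ ⊗ₖ (gHalf N)⁻¹)

lemma bGi_mul (N : ℕ) : bGi N * bG N = 1 := by
  rw [bG, bGi, ← Matrix.mul_kronecker_mul, ← Matrix.mul_kronecker_mul,
    Matrix.nonsing_inv_mul _ (gHalf_unit N), Matrix.one_kronecker_one, Matrix.one_kronecker_one]

lemma R12_conj {N : ℕ} (ξ ζ τ : ℂ) :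
    R12of N (Rmat N ξ ζ τ) = bK N ξ ζ τ • (bG N * bR τ bX12 ξ (ζ / N) * bGi N) := by
  rw [Rmat, Zmat_eq, Matrix.inv_kronecker, Finset.mul_sum, Finset.sum_mul]
  simp only [mul_smul_comm, smul_mul_assoc]
  rw [R12_lin, bR, Finset.mul_sum, Finset.sum_mul, Finset.smul_sum]
  refine Finset.sum_congr rfl fun a _ => ?_
  rw [mul_smul_comm, smul_mul_assoc, smul_smul, bX12, bY, R12_kron, bG, bGi]
  simp only [← Matrix.mul_kronecker_mul, R12_kron, mul_one, Matrix.mul_nonsing_inv _ (gHalf_unit N)]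

lemma R13_conj {N : ℕ} (ξ ζ τ : ℂ) :
    R13of N (Rmat N ξ ζ τ) = bK N ξ ζ τ • (bG N * bR τ bX13 ξ (ζ / N) * bGi N) := by
  rw [Rmat, Zmat_eq, Matrix.inv_kronecker, Finset.mul_sum, Finset.sum_mul]
  simp only [mul_smul_comm, smul_mul_assoc]
  rw [R13_lin, bR, Finset.mul_sum, Finset.sum_mul, Finset.smul_sum]
  refine Finset.sum_congr rfl fun a _ => ?_
  rw [mul_smul_comm, smul_mul_assoc, smul_smul, bX13, bY, R13_kron, bG, bGi]
  simp only [← Matrix.mul_kronecker_mul, R13_kron, mul_one, Matrix.mul_nonsing_inv _ (gHalf_unit N)]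

lemma R23_conj {N : ℕ} (ξ ζ τ : ℂ) :
    R23of N (Rmat N ξ ζ τ) = bK N ξ ζ τ • (bG N * bR τ bX23 ξ (ζ / N) * bGi N) := by
  rw [Rmat, Zmat_eq, Matrix.inv_kronecker, Finset.mul_sum, Finset.sum_mul]
  simp only [mul_smul_comm, smul_mul_assoc]
  rw [R23_lin, bR, Finset.mul_sum, Finset.sum_mul, Finset.smul_sum]
  refine Finset.sum_congr rfl fun a _ => ?_
  rw [mul_smul_comm, smul_mul_assoc, smul_smul, bX23, bY, R23_kron, bG, bGi]
  simp only [← Matrix.mul_kronecker_mul, R23_kron, mul_one, Matrix.mul_nonsing_inv _ (gHalf_unit N)]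

lemma bconj_mul3 {M : Type*} [Monoid M] (G H A B C : M) (h : H * G = 1) :
    (G * A * H) * (G * B * H) * (G * C * H) = G * (A * B * C) * H := by
  calc _ = G * A * (H * G) * B * (H * G) * C * H := by simp only [mul_assoc]
    _ = _ := by simp only [h, mul_one, mul_assoc]

/-- The Belavin R-matrix satisfies the Yang–Baxter equation
`R₁₂(z₁) R₁₃(z₂) R₂₃(z₂/z₁) = R₂₃(z₂/z₁) R₁₃(z₂) R₁₂(z₁)`, where `z₁ = eπ ξ₁`,
`z₂ = eπ ξ₂`, `z₂/z₁ = eπ (ξ₂ - ξ₁)`. -/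
theorem belavin_yang_baxter (N : ℕ) (hN : 2 ≤ N) (ξ₁ ξ₂ ζ τ : ℂ)
    (hτ : 0 < τ.im) (hζ : 0 < ζ.im)
    (h1 : Rgeneric N ξ₁ ζ τ) (h2 : Rgeneric N ξ₂ ζ τ) (h3 : Rgeneric N (ξ₂ - ξ₁) ζ τ) :
    R12of N (Rmat N ξ₁ ζ τ) * R13of N (Rmat N ξ₂ ζ τ) * R23of N (Rmat N (ξ₂ - ξ₁) ζ τ) =
      R23of N (Rmat N (ξ₂ - ξ₁) ζ τ) * R13of N (Rmat N ξ₂ ζ τ) * R12of N (Rmat N ξ₁ ζ τ) := by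
  haveI : NeZero N := ⟨by omega⟩
  have hh : ∀ a : Fin N × Fin N, bth τ (ζ / N + bpt N τ (bι a)) ≠ 0 := by
    intro a h0
    apply h1.2.1 a
    rw [bel_jTheta_pt, h0, mul_zero]
  have Y := bR_ybe hN hτ ⟨_, hh 0⟩ ξ₁ (ξ₂ - ξ₁) (ζ / N) hh
  rw [add_sub_cancel] at Y
  rw [R12_conj, R13_conj, R23_conj]
  simp only [smul_mul_smul_comm]
  rw [bconj_mul3 _ _ _ _ _ (bGi_mul N), bconj_mul3 _ _ _ _ _ (bGi_mul N), Y]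
  congr 1
  ring


end
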